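/- Let P be a non-constant polynomial on ℝⁿ of degree at most d. Then for every compact convex set F ⊂ ℝⁿ with positive volume, there exists a constant C ∈ ℝ such that (1/Vol(F)) ∫_F |log|P(x)| − C| dx ≤ ((4 + log 4)/2) · d. In particular, the BMO norm of log|P|, defined as the supremum over all compact convex sets F ⊂ ℝⁿ of inf_{C ∈ ℝ} (1/Vol(F)) ∫_F |log|P| − C|, is at most ((4 + log 4)/2) · d. -/

import Mathlib

open MeasureTheory

section

open Set Filter Topology
open scoped ENNReal Pointwise

/-- The superadditivity of Lebesgue measure on the line for compact sets. -/
lemma volume_add_volume_le_of_isCompact {A B C : Set ℝ} (hA : IsCompact A) (hB : IsCompact B)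
    (hAne : A.Nonempty) (hBne : B.Nonempty) (h : ∀ x ∈ A, ∀ y ∈ B, x + y ∈ C) :
    volume A + volume B ≤ volume C := by
  obtain ⟨a, ha, ha'⟩ := hA.exists_isGreatest hAne
  obtain ⟨b, hb, hb'⟩ := hB.exists_isLeast hBne
  have hd : AEDisjoint volume ((fun x => x + b) '' A) ((fun y => a + y) '' B) := by
    refine measure_mono_null (t := {a + b}) ?_ (by simp)
    rintro z ⟨⟨x, hx, rfl⟩, ⟨y, hy, hxy⟩⟩
    have h1 := ha' hx
    have h2 := hb' hy
    simp only [mem_singleton_iff] at *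
    linarith
  have hm : NullMeasurableSet ((fun y => a + y) '' B) :=
    (hB.image (by fun_prop)).measurableSet.nullMeasurableSet
  have h1 : volume ((fun x => x + b) '' A) = volume A := by simp
  have h2 : volume ((fun y => a + y) '' B) = volume B := by simp
  rw [← h1, ← h2, ← measure_union₀ hm hd]
  refine measure_mono ?_
  rintro z (⟨x, hx, rfl⟩ | ⟨y, hy, rfl⟩)
  · exact h x hx b hb
  · exact h a ha y hy

/-- The one-dimensional Brunn-Minkowski inequality. -/
lemma volume_add_volume_le {A B C : Set ℝ} (hA : MeasurableSet A) (hB : MeasurableSet B)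
    (hAne : A.Nonempty) (hBne : B.Nonempty) (h : ∀ x ∈ A, ∀ y ∈ B, x + y ∈ C) :
    volume A + volume B ≤ volume C := by
  obtain ⟨a, ha⟩ := hAne
  obtain ⟨b, hb⟩ := hBne
  rw [hA.measure_eq_iSup_isCompact, hB.measure_eq_iSup_isCompact]
  simp only [iSup_and']
  refine ENNReal.biSup_add_biSup_le' ⟨∅, by simp⟩ ⟨∅, by simp⟩ ?_
  rintro K ⟨hKA, hK⟩ L ⟨hLB, hL⟩
  refine le_trans (add_le_add (measure_mono (subset_insert a K)) (measure_mono (subset_insert b L)))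
    (volume_add_volume_le_of_isCompact (hK.insert a) (hL.insert b) (insert_nonempty _ _)
      (insert_nonempty _ _) fun x hx y hy => h x ?_ y ?_)
  · exact insert_subset ha hKA hx
  · exact insert_subset hb hLB hy

lemma volume_convex_comb_le {A B C : Set ℝ} (hA : MeasurableSet A) (hB : MeasurableSet B)
    (hAne : A.Nonempty) (hBne : B.Nonempty) {t : ℝ} (ht0 : 0 < t) (ht1 : t < 1)
    (h : ∀ x ∈ A, ∀ y ∈ B, (1 - t) * x + t * y ∈ C) :
    ENNReal.ofReal (1 - t) * volume A + ENNReal.ofReal t * volume B ≤ volume C := by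
  have key := volume_add_volume_le (A := (1 - t) • A) (B := t • B) (C := C)
    (hA.const_smul_of_ne_zero (by linarith : (1 - t) ≠ 0)) (hB.const_smul_of_ne_zero ht0.ne')
    hAne.smul_set hBne.smul_set ?_
  · simpa [Measure.addHaar_smul, abs_of_pos ht0, abs_of_pos (sub_pos.2 ht1)] using key
  · rintro _ ⟨x, hx, rfl⟩ _ ⟨y, hy, rfl⟩
    exact h x hx y hy

/-- Layer cake formula for finite `ℝ≥0∞`-valued functions. -/
lemma lintegral_eq_lintegral_superlevel {α : Type*} [MeasurableSpace α] (μ : Measure α)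
    {f : α → ℝ≥0∞} (hf : Measurable f) (hfin : ∀ x, f x ≠ ∞) :
    ∫⁻ x, f x ∂μ = ∫⁻ s in Ioi (0 : ℝ), μ {x | ENNReal.ofReal s < f x} := by
  have h := lintegral_eq_lintegral_meas_lt μ (f := fun x => (f x).toReal)
    (Eventually.of_forall fun x => ENNReal.toReal_nonneg) hf.ennreal_toReal.aemeasurable
  simp only [ENNReal.ofReal_toReal (hfin _)] at h
  rw [h]
  refine setLIntegral_congr_fun measurableSet_Ioi fun s hs => ?_
  congr 1
  ext x
  exact (ENNReal.ofReal_lt_iff_lt_toReal (le_of_lt hs) (hfin x)).symm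

lemma ENNReal.geom_mean_le_arith_mean2 {t : ℝ} (ht0 : 0 < t) (ht1 : t < 1) (x y : ℝ≥0∞) :
    x ^ (1 - t) * y ^ t ≤ ENNReal.ofReal (1 - t) * x + ENNReal.ofReal t * y := by
  have h1 : 0 < 1 - t := sub_pos.2 ht1
  rcases eq_or_ne x ∞ with rfl | hx
  · rw [ENNReal.mul_top (by simpa using ht1)]; simp
  rcases eq_or_ne y ∞ with rfl | hy
  · rw [ENNReal.mul_top (by simpa using ht0)]; simp
  lift x to NNReal using hx
  lift y to NNReal using hy
  have := NNReal.geom_mean_le_arith_mean2_weighted (Real.toNNReal (1 - t)) (Real.toNNReal t) x y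
    (by rw [← Real.toNNReal_add h1.le ht0.le]; simp)
  rw [Real.coe_toNNReal _ h1.le, Real.coe_toNNReal _ ht0.le] at this
  rw [← ENNReal.coe_rpow_of_nonneg _ h1.le, ← ENNReal.coe_rpow_of_nonneg _ ht0.le,
    ENNReal.ofReal, ENNReal.ofReal]
  exact_mod_cast this

lemma prekopa_leindler_of_iSup_eq_one {f g h : ℝ → ℝ≥0∞} (hf : Measurable f) (hg : Measurable g)
    (hh : Measurable h) {t : ℝ} (ht0 : 0 < t) (ht1 : t < 1)
    (hf1 : ⨆ x, f x = 1) (hg1 : ⨆ x, g x = 1)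
    (H : ∀ x y, f x ^ (1 - t) * g y ^ t ≤ h ((1 - t) * x + t * y)) :
    (∫⁻ x, f x) ^ (1 - t) * (∫⁻ x, g x) ^ t ≤ ∫⁻ x, h x := by
  have h1t : 0 < 1 - t := sub_pos.2 ht1
  refine (ENNReal.geom_mean_le_arith_mean2 ht0 ht1 _ _).trans ?_
  have hfle : ∀ x, f x ≤ 1 := fun x => hf1 ▸ le_iSup f x
  have hgle : ∀ x, g x ≤ 1 := fun x => hg1 ▸ le_iSup g x
  refine le_trans ?_ (lintegral_mono (f := fun x => min (h x) 1) fun x => min_le_left _ _)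
  rw [lintegral_eq_lintegral_superlevel _ hf fun x => ((hfle x).trans_lt ENNReal.one_lt_top).ne,
    lintegral_eq_lintegral_superlevel _ hg fun x => ((hgle x).trans_lt ENNReal.one_lt_top).ne,
    lintegral_eq_lintegral_superlevel _ (hh.min measurable_const)
      fun x => ((min_le_right _ _).trans_lt ENNReal.one_lt_top).ne]
  have hanti : ∀ F : ℝ → ℝ≥0∞, Measurable fun s : ℝ => volume {x | ENNReal.ofReal s < F x} := by
    intro F
    refine Antitone.measurable fun s s' hs => measure_mono fun x hx => ?_
    exact (ENNReal.ofReal_le_ofReal hs).trans_lt hx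
  rw [← lintegral_const_mul _ (hanti f), ← lintegral_const_mul _ (hanti g),
    ← lintegral_add_left ((hanti f).const_mul _)]
  refine lintegral_mono fun s => ?_
  rcases lt_or_ge (ENNReal.ofReal s) 1 with hs | hs
  · refine volume_convex_comb_le (measurableSet_lt measurable_const hf)
      (measurableSet_lt measurable_const hg) (lt_iSup_iff.1 (hs.trans_eq hf1.symm))
      (lt_iSup_iff.1 (hs.trans_eq hg1.symm)) ht0 ht1 fun x hx y hy => ?_
    refine lt_min (lt_of_lt_of_le ?_ (H x y)) hs
    calc ENNReal.ofReal s = ENNReal.ofReal s ^ (1 - t) * ENNReal.ofReal s ^ t := by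
          rw [← ENNReal.rpow_add_of_nonneg _ _ h1t.le ht0.le]; simp
      _ < f x ^ (1 - t) * g y ^ t :=
          ENNReal.mul_lt_mul (ENNReal.rpow_lt_rpow hx h1t) (ENNReal.rpow_lt_rpow hy ht0)
  · have e1 : {x | ENNReal.ofReal s < f x} = ∅ :=
      eq_empty_of_forall_notMem fun x hx => absurd (hs.trans_lt hx) (hfle x).not_gt
    have e2 : {x | ENNReal.ofReal s < g x} = ∅ :=
      eq_empty_of_forall_notMem fun x hx => absurd (hs.trans_lt hx) (hgle x).not_gt
    simp [e1, e2]

lemma prekopa_leindler_of_bounded {f g h : ℝ → ℝ≥0∞} (hf : Measurable f) (hg : Measurable g)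
    (hh : Measurable h) {t : ℝ} (ht0 : 0 < t) (ht1 : t < 1)
    (hfb : ⨆ x, f x ≠ ∞) (hgb : ⨆ x, g x ≠ ∞)
    (H : ∀ x y, f x ^ (1 - t) * g y ^ t ≤ h ((1 - t) * x + t * y)) :
    (∫⁻ x, f x) ^ (1 - t) * (∫⁻ x, g x) ^ t ≤ ∫⁻ x, h x := by
  have h1t : 0 < 1 - t := sub_pos.2 ht1
  set a := ⨆ x, f x with ha
  set b := ⨆ x, g x with hb
  rcases eq_or_ne a 0 with ha0 | ha0
  · have : ∀ x, f x = 0 := by simpa [ha] using ha0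
    simp [this, ENNReal.zero_rpow_of_pos h1t]
  rcases eq_or_ne b 0 with hb0 | hb0
  · have : ∀ x, g x = 0 := by simpa [hb] using hb0
    simp [this, ENNReal.zero_rpow_of_pos ht0]
  have hc0 : a ^ (1 - t) * b ^ t ≠ 0 :=
    mul_ne_zero (ENNReal.rpow_pos (pos_iff_ne_zero.2 ha0) hfb).ne'
      (ENNReal.rpow_pos (pos_iff_ne_zero.2 hb0) hgb).ne'
  have hct : a ^ (1 - t) * b ^ t ≠ ∞ :=
    ENNReal.mul_ne_top (ENNReal.rpow_ne_top_of_nonneg h1t.le hfb)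
      (ENNReal.rpow_ne_top_of_nonneg ht0.le hgb)
  have hinv : (a⁻¹) ^ (1 - t) * (b⁻¹) ^ t = (a ^ (1 - t) * b ^ t)⁻¹ := by
    rw [ENNReal.inv_rpow, ENNReal.inv_rpow, ENNReal.mul_inv]
    · right; exact ENNReal.rpow_ne_top_of_nonneg ht0.le hgb
    · left; exact ENNReal.rpow_ne_top_of_nonneg h1t.le hfb
  have key := prekopa_leindler_of_iSup_eq_one (f := fun x => a⁻¹ * f x) (g := fun x => b⁻¹ * g x)
    (h := fun x => (a ^ (1 - t) * b ^ t)⁻¹ * h x) (hf.const_mul _) (hg.const_mul _)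
    (hh.const_mul _) ht0 ht1
    (by rw [← ENNReal.mul_iSup, ← ha, ENNReal.inv_mul_cancel ha0 hfb])
    (by rw [← ENNReal.mul_iSup, ← hb, ENNReal.inv_mul_cancel hb0 hgb]) ?_
  · rw [lintegral_const_mul _ hf, lintegral_const_mul _ hg, lintegral_const_mul _ hh,
      ENNReal.mul_rpow_of_nonneg _ _ h1t.le, ENNReal.mul_rpow_of_nonneg _ _ ht0.le,
      mul_mul_mul_comm, hinv] at key
    have := mul_le_mul_right key (a ^ (1 - t) * b ^ t)
    rwa [← mul_assoc, ← mul_assoc _ _ (∫⁻ x, h x), ENNReal.mul_inv_cancel hc0 hct, one_mul,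
      one_mul] at this
  · intro x y
    rw [ENNReal.mul_rpow_of_nonneg _ _ h1t.le, ENNReal.mul_rpow_of_nonneg _ _ ht0.le,
      mul_mul_mul_comm, hinv]
    gcongr
    exact H x y

/-- The Prékopa–Leindler inequality on the line. -/
lemma prekopa_leindler_real {f g h : ℝ → ℝ≥0∞} (hf : Measurable f) (hg : Measurable g)
    (hh : Measurable h) {t : ℝ} (ht0 : 0 < t) (ht1 : t < 1)
    (H : ∀ x y, f x ^ (1 - t) * g y ^ t ≤ h ((1 - t) * x + t * y)) :
    (∫⁻ x, f x) ^ (1 - t) * (∫⁻ x, g x) ^ t ≤ ∫⁻ x, h x := by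
  have h1t : 0 < 1 - t := sub_pos.2 ht1
  have hlim : ∀ F : ℝ → ℝ≥0∞, Measurable F →
      Tendsto (fun k : ℕ => ∫⁻ x, min (F x) k) atTop (𝓝 (∫⁻ x, F x)) := by
    intro F hF
    refine lintegral_tendsto_of_tendsto_of_monotone
      (fun k => (hF.min measurable_const).aemeasurable) ?_ ?_
    · exact Eventually.of_forall fun x k l hkl => min_le_min_left _ (by exact_mod_cast hkl)
    · refine Eventually.of_forall fun x => ?_
      simpa using (tendsto_const_nhds (x := F x)).min ENNReal.tendsto_nat_nhds_top
  have hb : ∀ k : ℕ, (∫⁻ x, min (f x) k) ^ (1 - t) * (∫⁻ x, min (g x) k) ^ t ≤ ∫⁻ x, h x := by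
    intro k
    refine prekopa_leindler_of_bounded (hf.min measurable_const) (hg.min measurable_const) hh ht0
      ht1 ?_ ?_ fun x y => le_trans ?_ (H x y)
    · exact ((iSup_le fun x => min_le_right _ _).trans_lt (ENNReal.natCast_lt_top k)).ne
    · exact ((iSup_le fun x => min_le_right _ _).trans_lt (ENNReal.natCast_lt_top k)).ne
    · gcongr <;> exact min_le_left _ _
  rcases eq_or_ne (∫⁻ x, f x) 0 with hf0 | hf0
  · simp [hf0, ENNReal.zero_rpow_of_pos h1t]
  rcases eq_or_ne (∫⁻ x, g x) 0 with hg0 | hg0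
  · simp [hg0, ENNReal.zero_rpow_of_pos ht0]
  refine le_of_tendsto (ENNReal.Tendsto.mul ((hlim f hf).ennrpow_const _) (Or.inl ?_)
    ((hlim g hg).ennrpow_const _) (Or.inl ?_)) (Eventually.of_forall hb)
  · simp [ENNReal.rpow_eq_zero_iff, hf0, ht1.le]
  · simp [ENNReal.rpow_eq_zero_iff, hg0, ht0.le]

lemma lintegral_pi_succ {n : ℕ} (i : Fin (n + 1)) {f : (Fin (n + 1) → ℝ) → ℝ≥0∞}
    (hf : Measurable f) :
    ∫⁻ x, f x = ∫⁻ u : ℝ, ∫⁻ y : Fin n → ℝ, f (i.insertNth u y) := by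
  have h := (volume_preserving_piFinSuccAbove (fun _ : Fin (n + 1) => ℝ) i).symm
  rw [← h.lintegral_comp hf, Measure.volume_eq_prod]
  exact lintegral_prod _ (hf.comp h.measurable).aemeasurable

/-- The Prékopa–Leindler inequality. -/
lemma prekopa_leindler {n : ℕ} {f g h : (Fin n → ℝ) → ℝ≥0∞} (hf : Measurable f)
    (hg : Measurable g) (hh : Measurable h) {t : ℝ} (ht0 : 0 < t) (ht1 : t < 1)
    (H : ∀ x y, f x ^ (1 - t) * g y ^ t ≤ h ((1 - t) • x + t • y)) :
    (∫⁻ x, f x) ^ (1 - t) * (∫⁻ x, g x) ^ t ≤ ∫⁻ x, h x := by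
  induction n with
  | zero =>
    rw [Measure.volume_pi_eq_dirac 0]
    simpa using H 0 0
  | succ n ih =>
    have hm : Measurable fun p : ℝ × (Fin n → ℝ) => (Fin.insertNth 0 p.1 p.2 : Fin (n + 1) → ℝ) :=
      (MeasurableEquiv.piFinSuccAbove (fun _ : Fin (n + 1) => ℝ) 0).symm.measurable
    rw [lintegral_pi_succ 0 hf, lintegral_pi_succ 0 hg, lintegral_pi_succ 0 hh]
    refine prekopa_leindler_real (hf.comp hm).lintegral_prod_right'
      (hg.comp hm).lintegral_prod_right' (hh.comp hm).lintegral_prod_right' ht0 ht1 fun u v => ?_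
    refine ih (by fun_prop) (by fun_prop) (by fun_prop) fun x y => ?_
    have hv : (Fin.insertNth 0 ((1 - t) * u + t * v) ((1 - t) • x + t • y) : Fin (n + 1) → ℝ) =
        (1 - t) • (Fin.insertNth 0 u x : Fin (n + 1) → ℝ) + t • Fin.insertNth 0 v y := by
      ext j
      refine Fin.cases ?_ (fun k => ?_) j <;> simp
    have := H (Fin.insertNth 0 u x) (Fin.insertNth 0 v y)
    rwa [← hv] at this

/-- The length of the fibre over `u` of the `i`-th coordinate projection of `K`. -/
noncomputable def fiberVolume {n : ℕ} (i : Fin (n + 1)) (K : Set (Fin (n + 1) → ℝ)) (u : ℝ) :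
    ℝ≥0∞ :=
  volume {y : Fin n → ℝ | i.insertNth u y ∈ K}

lemma measurable_insertNth {n : ℕ} (i : Fin (n + 1)) :
    Measurable fun p : ℝ × (Fin n → ℝ) => (i.insertNth p.1 p.2 : Fin (n + 1) → ℝ) :=
  (MeasurableEquiv.piFinSuccAbove (fun _ : Fin (n + 1) => ℝ) i).symm.measurable

lemma measurableSet_fiber {n : ℕ} (i : Fin (n + 1)) {K : Set (Fin (n + 1) → ℝ)}
    (hK : MeasurableSet K) (u : ℝ) : MeasurableSet {y : Fin n → ℝ | i.insertNth u y ∈ K} :=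
  ((measurable_insertNth i).comp measurable_prodMk_left) hK

lemma measurable_fiberVolume {n : ℕ} (i : Fin (n + 1)) {K : Set (Fin (n + 1) → ℝ)}
    (hK : MeasurableSet K) : Measurable (fiberVolume i K) :=
  measurable_measure_prodMk_left (measurable_insertNth i hK)

lemma volume_inter_coord_preimage {n : ℕ} (i : Fin (n + 1)) {K : Set (Fin (n + 1) → ℝ)}
    (hK : MeasurableSet K) {B : Set ℝ} (hB : MeasurableSet B) :
    volume (K ∩ {x | x i ∈ B}) = ∫⁻ u in B, fiberVolume i K u := by
  have hB' : MeasurableSet {x : Fin (n + 1) → ℝ | x i ∈ B} := measurable_pi_apply i hB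
  rw [← lintegral_indicator_one (hK.inter hB'), lintegral_pi_succ i
    (measurable_one.indicator (hK.inter hB')), ← lintegral_indicator hB]
  refine lintegral_congr fun u => ?_
  by_cases hu : u ∈ B
  · rw [indicator_of_mem hu, fiberVolume, ← lintegral_indicator_one (measurableSet_fiber i hK u)]
    refine lintegral_congr fun y => ?_
    have hiff : (i.insertNth u y : Fin (n + 1) → ℝ) ∈ K ∩ {x | x i ∈ B} ↔
        (i.insertNth u y : Fin (n + 1) → ℝ) ∈ K := by simp [hu]
    by_cases hy : (i.insertNth u y : Fin (n + 1) → ℝ) ∈ K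
    · rw [indicator_of_mem (hiff.2 hy), indicator_of_mem (show y ∈ {y | i.insertNth u y ∈ K} from hy)]
      rfl
    · rw [indicator_of_notMem (mt hiff.1 hy),
        indicator_of_notMem (show y ∉ {y | i.insertNth u y ∈ K} from hy)]
  · rw [indicator_of_notMem hu]
    simp [indicator, hu]

lemma fiberVolume_logConcave {n : ℕ} (i : Fin (n + 1)) {K : Set (Fin (n + 1) → ℝ)}
    (hK : MeasurableSet K) (hc : Convex ℝ K) {t : ℝ} (ht0 : 0 < t) (ht1 : t < 1) (u v : ℝ) :
    fiberVolume i K u ^ (1 - t) * fiberVolume i K v ^ t ≤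
      fiberVolume i K ((1 - t) * u + t * v) := by
  have h1t : 0 < 1 - t := sub_pos.2 ht1
  simp only [fiberVolume]
  rw [← lintegral_indicator_one (measurableSet_fiber i hK u),
    ← lintegral_indicator_one (measurableSet_fiber i hK v),
    ← lintegral_indicator_one (measurableSet_fiber i hK _)]
  refine prekopa_leindler (measurable_one.indicator (measurableSet_fiber i hK _))
    (measurable_one.indicator (measurableSet_fiber i hK _))
    (measurable_one.indicator (measurableSet_fiber i hK _)) ht0 ht1 fun x y => ?_
  by_cases hx : i.insertNth u x ∈ K
  · by_cases hy : i.insertNth v y ∈ K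
    · have hxy : i.insertNth ((1 - t) * u + t * v) ((1 - t) • x + t • y) ∈ K := by
        convert hc hx hy h1t.le ht0.le (by ring) using 1
        ext j
        refine Fin.succAboveCases i ?_ (fun k => ?_) j <;> simp
      rw [indicator_of_mem (show x ∈ {y | i.insertNth u y ∈ K} from hx),
        indicator_of_mem (show y ∈ {y | i.insertNth v y ∈ K} from hy),
        indicator_of_mem (show (1 - t) • x + t • y ∈
          {y | i.insertNth ((1 - t) * u + t * v) y ∈ K} from hxy)]
      simp
    · simp [indicator, hy, ENNReal.zero_rpow_of_pos ht0]
  · simp [indicator, hx, ENNReal.zero_rpow_of_pos h1t]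

lemma volume_real_inter_Icc_add {S : Set ℝ} {x y z : ℝ} (hxy : x ≤ y)
    (hyz : y ≤ z) : volume.real (S ∩ Icc x z) =
      volume.real (S ∩ Icc x y) + volume.real (S ∩ Icc y z) := by
  have hfin : ∀ u v, volume (S ∩ Icc u v) ≠ ∞ := fun u v =>
    ((measure_mono inter_subset_right).trans_lt measure_Icc_lt_top).ne
  have hfin' : ∀ u v, volume (S ∩ Ioc u v) ≠ ∞ := fun u v =>
    ((measure_mono inter_subset_right).trans_lt measure_Ioc_lt_top).ne
  have h1 : ∀ u v, volume.real (S ∩ Icc u v) = volume.real (S ∩ Ioc u v) := fun u v =>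
    measureReal_congr ((ae_eq_refl S).inter Ioc_ae_eq_Icc.symm)
  rw [h1, h1, h1, ← Ioc_union_Ioc_eq_Ioc hxy hyz, inter_union_distrib_left]
  have := measure_inter_add_sdiff (μ := volume) (S ∩ Ioc x y ∪ S ∩ Ioc y z) (measurableSet_Iic (a := y))
  rw [show (S ∩ Ioc x y ∪ S ∩ Ioc y z) ∩ Iic y = S ∩ Ioc x y by
      ext u; simp only [mem_inter_iff, mem_union, mem_Ioc, mem_Iic]; grind,
    show (S ∩ Ioc x y ∪ S ∩ Ioc y z) \ Iic y = S ∩ Ioc y z by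
      ext u; simp only [mem_inter_iff, mem_union, mem_Ioc, mem_Iic, Set.mem_sdiff]; grind] at this
  rw [Measure.real, ← this, ENNReal.toReal_add (hfin' _ _) (hfin' _ _)]
  rfl

/-- If every interval meeting `G` has at most a proportion `κ` of its length in `E`, then
the same holds with the length of the interval replaced by the length of its part outside `G`. -/
lemma volume_inter_Icc_le_mul_compl {E G : Set ℝ} (hE : IsClosed E) (hG : IsClosed G)
    (hd : Disjoint E G) {κ : ℝ} (hκ : 0 ≤ κ)
    (H : ∀ a b, (G ∩ Icc a b).Nonempty → volume.real (E ∩ Icc a b) ≤ κ * (b - a))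
    {a b : ℝ} (hne : (G ∩ Icc a b).Nonempty) :
    volume.real (E ∩ Icc a b) ≤ κ * volume.real (Gᶜ ∩ Icc a b) := by
  have hcpt : ∀ u v, IsCompact (G ∩ Icc u v) := fun u v => isCompact_Icc.inter_left hG
  obtain ⟨g₀, ⟨hg₀G, hg₀⟩, hmin⟩ := (hcpt a b).exists_isLeast hne
  have hgap : ∀ u v, u ≤ v → (∀ x ∈ G, x ∈ Ioo u v → False) →
      volume.real (Gᶜ ∩ Icc u v) = v - u := by
    intro u v huv h
    rw [← Real.volume_real_Ioo_of_le huv]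
    refine le_antisymm ?_ (measureReal_mono (fun x hx => ⟨fun hxG => h x hxG hx, Ioo_subset_Icc_self hx⟩)
      ((measure_mono inter_subset_right).trans_lt measure_Icc_lt_top).ne)
    rw [measureReal_congr (μ := volume) (s := Ioo u v) Ioo_ae_eq_Icc]
    exact measureReal_mono inter_subset_right measure_Icc_lt_top.ne
  obtain ⟨δ, hδ, hdis⟩ := (hd.symm.mono_left (inter_subset_left (t := Icc a b))).exists_cthickenings
    (hcpt a b) hE
  have hnear : ∀ g ∈ G ∩ Icc a b, ∀ u, g - δ ≤ u → volume.real (E ∩ Icc u g) = 0 := by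
    intro g hg u hu
    suffices E ∩ Icc u g = ∅ by simp [this]
    refine eq_empty_of_forall_notMem fun x hx => ?_
    refine disjoint_left.1 hdis (Metric.mem_cthickening_of_dist_le x g δ _ hg ?_)
      (Metric.self_subset_cthickening _ hx.1)
    rw [Real.dist_eq, abs_le]
    constructor <;> linarith [hx.2.1, hx.2.2]
  have hbase : volume.real (E ∩ Icc a g₀) ≤ κ * volume.real (Gᶜ ∩ Icc a g₀) := by
    rw [hgap a g₀ hg₀.1]
    · exact H a g₀ ⟨g₀, hg₀G, hg₀.1, le_rfl⟩
    · intro x hx hx'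
      exact absurd (hmin ⟨hx, hx'.1.le, hx'.2.le.trans hg₀.2⟩) (not_le.2 hx'.2)
  have hstep : ∀ u v, a ≤ u → u ≤ v → volume.real (E ∩ Icc a u) ≤ κ * volume.real (Gᶜ ∩ Icc a u) →
      volume.real (E ∩ Icc u v) ≤ κ * volume.real (Gᶜ ∩ Icc u v) →
      volume.real (E ∩ Icc a v) ≤ κ * volume.real (Gᶜ ∩ Icc a v) := by
    intro u v hau huv h1 h2
    rw [volume_real_inter_Icc_add hau huv, volume_real_inter_Icc_add hau huv, mul_add]
    exact add_le_add h1 h2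
  have main : ∀ k : ℕ, ∀ z ∈ Icc g₀ b, z ≤ g₀ + k * δ →
      volume.real (E ∩ Icc a z) ≤ κ * volume.real (Gᶜ ∩ Icc a z) := by
    intro k
    induction k with
    | zero =>
      intro z hz hzk
      have : z = g₀ := le_antisymm (by simpa using hzk) hz.1
      rwa [this]
    | succ k ih =>
      intro z hz hzk
      obtain ⟨g, ⟨hgG, hg⟩, hmax⟩ := (hcpt g₀ z).exists_isGreatest ⟨g₀, hg₀G, le_rfl, hz.1⟩
      have hgab : g ∈ G ∩ Icc a b := ⟨hgG, hg₀.1.trans hg.1, hg.2.trans hz.2⟩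
      have hpos : ∀ u v, 0 ≤ κ * volume.real (Gᶜ ∩ Icc u v) := fun u v =>
        mul_nonneg hκ measureReal_nonneg
      refine hstep g z hgab.2.1 hg.2 ?_ ?_
      · rcases le_total (g - δ) g₀ with h | h
        · exact hstep g₀ g hg₀.1 hg.1 hbase ((hnear g hgab g₀ h).le.trans (hpos _ _))
        · refine hstep (g - δ) g (hg₀.1.trans h) (by linarith) (ih _ ⟨h, ?_⟩ ?_)
            ((hnear g hgab _ le_rfl).le.trans (hpos _ _))
          · linarith [hgab.2.2]
          · push_cast at hzk
            linarith [hg.2]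
      · rw [hgap g z hg.2]
        · exact H g z ⟨g, hgG, le_rfl, hg.2⟩
        · intro x hx hx'
          exact absurd (hmax ⟨hx, hg.1.trans hx'.1.le, hx'.2.le⟩) (not_le.2 hx'.1)
  obtain ⟨k, hk⟩ := exists_nat_ge ((b - g₀) / δ)
  refine main k b ⟨hg₀.2, le_rfl⟩ ?_
  rw [div_le_iff₀ hδ] at hk
  linarith

lemma ordConnected_ae_eq_Icc {D : Set ℝ} (hD : D.OrdConnected) (hb : BddBelow D) (ha : BddAbove D)
    (hne : D.Nonempty) : D =ᵐ[volume] Icc (sInf D) (sSup D) := by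
  have h1 : D ⊆ Icc (sInf D) (sSup D) := fun x hx => ⟨csInf_le hb hx, le_csSup ha hx⟩
  have h2 : Ioo (sInf D) (sSup D) ⊆ D := by
    rintro x ⟨hx1, hx2⟩
    obtain ⟨y, hy, hyx⟩ := exists_lt_of_csInf_lt hne hx1
    obtain ⟨z, hz, hxz⟩ := exists_lt_of_lt_csSup hne hx2
    exact hD.out hy hz ⟨hyx.le, hxz.le⟩
  exact h1.eventuallyLE.antisymm (Ioo_ae_eq_Icc.symm.le.trans h2.eventuallyLE)

lemma volume_inter_le_mul_compl {E G : Set ℝ} (hE : IsClosed E) (hG : IsClosed G)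
    (hd : Disjoint E G) {κ : ℝ} (hκ : 0 ≤ κ)
    (H : ∀ a b, (G ∩ Icc a b).Nonempty → volume.real (E ∩ Icc a b) ≤ κ * (b - a))
    {D : Set ℝ} (hD : D.OrdConnected) (hb : BddBelow D) (ha : BddAbove D)
    (hne : (G ∩ D).Nonempty) :
    volume.real (E ∩ D) ≤ κ * volume.real (Gᶜ ∩ D) := by
  have hae := ordConnected_ae_eq_Icc hD hb ha (hne.mono inter_subset_right)
  rw [measureReal_congr ((ae_eq_refl E).inter hae), measureReal_congr ((ae_eq_refl (Gᶜ : Set ℝ)).inter hae)]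
  refine volume_inter_Icc_le_mul_compl hE hG hd hκ H ?_
  obtain ⟨x, hxG, hx⟩ := hne
  exact ⟨x, hxG, csInf_le hb hx, le_csSup ha hx⟩

lemma lintegral_Ioi_eq_lintegral_exp_neg (f : ℝ → ℝ≥0∞) :
    ∫⁻ t in Ioi (0 : ℝ), f t = ∫⁻ s : ℝ, ENNReal.ofReal (Real.exp (-s)) * f (Real.exp (-s)) := by
  have himg : (fun s : ℝ => Real.exp (-s)) '' univ = Ioi 0 := by
    ext t
    simp only [image_univ, mem_range, mem_Ioi]
    refine ⟨fun ⟨s, hs⟩ => hs ▸ Real.exp_pos _, fun ht => ⟨-Real.log t, ?_⟩⟩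
    rw [neg_neg, Real.exp_log ht]
  have := lintegral_image_eq_lintegral_abs_deriv_mul (s := univ) (f := fun s : ℝ => Real.exp (-s))
    (f' := fun s => -Real.exp (-s)) MeasurableSet.univ (fun s _ => ?_) ?_ f
  · rw [himg, setLIntegral_univ] at this
    simpa [abs_neg, abs_of_pos (Real.exp_pos _)] using this
  · have := ((hasDerivAt_neg s).exp).hasDerivWithinAt (s := univ)
    simpa using this
  · intro x _ y _ h
    simpa using h

lemma mul_sub_le_rpow_sub_rpow {κ q Q W : ℝ} (hκ0 : 0 < κ) (hκ1 : κ ≤ 1) (hq : 0 ≤ q)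
    (hqQ : q ≤ Q) (hQW : Q ≤ W) :
    κ * (Q - q) ≤ W ^ (1 - κ) * Q ^ κ - W ^ (1 - κ) * q ^ κ := by
  rcases (hq.trans hqQ).eq_or_lt with h0 | hQ
  · have : q = 0 := le_antisymm (h0 ▸ hqQ) hq
    simp [this, ← h0]
  have hb := rpow_one_add_le_one_add_mul_self (s := q / Q - 1)
    (by have := div_nonneg hq hQ.le; linarith) hκ0.le hκ1
  rw [add_sub_cancel, Real.div_rpow hq hQ.le, div_le_iff₀ (Real.rpow_pos_of_pos hQ _)] at hb
  have h1 : κ * (1 - q / Q) * Q ^ κ ≤ Q ^ κ - q ^ κ := by linarith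
  have h2 : Q ^ (1 - κ) ≤ W ^ (1 - κ) := Real.rpow_le_rpow hQ.le hQW (by linarith)
  have h3 : Q ^ (1 - κ) * Q ^ κ = Q := by rw [← Real.rpow_add hQ]; simp
  have h4 : 0 ≤ 1 - q / Q := by rw [sub_nonneg, div_le_one hQ]; exact hqQ
  calc κ * (Q - q) = κ * (1 - q / Q) * (Q ^ (1 - κ) * Q ^ κ) := by rw [h3]; field_simp
    _ = Q ^ (1 - κ) * (κ * (1 - q / Q) * Q ^ κ) := by ring
    _ ≤ W ^ (1 - κ) * (Q ^ κ - q ^ κ) := by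
      exact mul_le_mul h2 h1 (mul_nonneg (mul_nonneg hκ0.le h4) (by positivity))
        (Real.rpow_nonneg (hQ.le.trans hQW) _)
    _ = _ := by ring

section Dilation

variable {w : ℝ → ℝ≥0∞}

/-- The open superlevel set of a weight. -/
def superlevel (w : ℝ → ℝ≥0∞) (t : ℝ) : Set ℝ := {x | ENNReal.ofReal t < w x}

lemma measurableSet_superlevel (hw : Measurable w) (t : ℝ) : MeasurableSet (superlevel w t) :=
  measurableSet_lt measurable_const hw

lemma superlevel_anti : Antitone (superlevel w) := fun _ _ h _ hx =>
  (ENNReal.ofReal_le_ofReal h).trans_lt hx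

lemma superlevel_comb
    (hlog : ∀ s : ℝ, 0 < s → s < 1 → ∀ x y, w x ^ (1 - s) * w y ^ s ≤ w ((1 - s) * x + s * y))
    {t₁ t₂ s : ℝ} (ht₁ : 0 < t₁) (ht₂ : 0 < t₂) (hs0 : 0 < s) (hs1 : s < 1) {x y : ℝ}
    (hx : x ∈ superlevel w t₁) (hy : y ∈ superlevel w t₂) :
    (1 - s) * x + s * y ∈ superlevel w (t₁ ^ (1 - s) * t₂ ^ s) := by
  have h1 : 0 < 1 - s := sub_pos.2 hs1
  refine lt_of_lt_of_le ?_ (hlog s hs0 hs1 x y)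
  rw [ENNReal.ofReal_mul (by positivity), ← ENNReal.ofReal_rpow_of_pos ht₁,
    ← ENNReal.ofReal_rpow_of_pos ht₂]
  exact ENNReal.mul_lt_mul (ENNReal.rpow_lt_rpow hx h1) (ENNReal.rpow_lt_rpow hy hs0)

lemma volume_superlevel_comb (hw : Measurable w)
    (hlog : ∀ s : ℝ, 0 < s → s < 1 → ∀ x y, w x ^ (1 - s) * w y ^ s ≤ w ((1 - s) * x + s * y))
    {t₁ t₂ s : ℝ} (ht₁ : 0 < t₁) (ht₂ : 0 < t₂) (hs0 : 0 < s) (hs1 : s < 1)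
    (h₁ : (superlevel w t₁).Nonempty) (h₂ : (superlevel w t₂).Nonempty) :
    ENNReal.ofReal (1 - s) * volume (superlevel w t₁) +
      ENNReal.ofReal s * volume (superlevel w t₂) ≤ volume (superlevel w (t₁ ^ (1 - s) * t₂ ^ s)) :=
  volume_convex_comb_le (measurableSet_superlevel hw _) (measurableSet_superlevel hw _) h₁ h₂
    hs0 hs1 fun _ hx _ hy => superlevel_comb hlog ht₁ ht₂ hs0 hs1 hx hy

lemma ordConnected_superlevel
    (hlog : ∀ s : ℝ, 0 < s → s < 1 → ∀ x y, w x ^ (1 - s) * w y ^ s ≤ w ((1 - s) * x + s * y))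
    {t : ℝ} (ht : 0 < t) : (superlevel w t).OrdConnected := by
  refine Convex.ordConnected (convex_iff_forall_pos.2 fun x hx y hy a b ha hb hab => ?_)
  have := superlevel_comb hlog ht ht hb (by linarith) hx hy
  rw [← Real.rpow_add ht, sub_add_cancel, Real.rpow_one] at this
  have ha' : 1 - b = a := by linarith
  rwa [ha'] at this

/-- The integral of the excess of the length of the superlevel sets is logarithmically concave
in the threshold. -/
lemma lintegral_excess_logConcave (hw : Measurable w)
    (hlog : ∀ s : ℝ, 0 < s → s < 1 → ∀ x y, w x ^ (1 - s) * w y ^ s ≤ w ((1 - s) * x + s * y))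
    {s : ℝ} (hs0 : 0 < s) (hs1 : s < 1) (l : ℝ≥0∞) (hl : l ≠ ∞) :
    (∫⁻ t in Ioi (0 : ℝ), volume (superlevel w t)) ^ (1 - s) *
      (∫⁻ t in Ioi (0 : ℝ), (volume (superlevel w t) - l)) ^ s ≤
      ∫⁻ t in Ioi (0 : ℝ), (volume (superlevel w t) - ENNReal.ofReal s * l) := by
  have h1 : 0 < 1 - s := sub_pos.2 hs1
  have hN : Measurable fun t => volume (superlevel w t) :=
    Antitone.measurable fun t t' h => measure_mono (superlevel_anti h)
  rw [lintegral_Ioi_eq_lintegral_exp_neg, lintegral_Ioi_eq_lintegral_exp_neg,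
    lintegral_Ioi_eq_lintegral_exp_neg]
  have he : Measurable fun x : ℝ => Real.exp (-x) := by fun_prop
  have hm : ∀ c : ℝ≥0∞, Measurable fun x : ℝ => ENNReal.ofReal (Real.exp (-x)) *
      (volume (superlevel w (Real.exp (-x))) - c) := fun c =>
    he.ennreal_ofReal.mul ((hN.comp he).sub measurable_const)
  refine prekopa_leindler_real (by simpa using hm 0) (hm l) (hm _) hs0 hs1 fun x y => ?_
  have hexp : Real.exp (-((1 - s) * x + s * y)) =
      Real.exp (-x) ^ (1 - s) * Real.exp (-y) ^ s := by
    rw [← Real.exp_mul, ← Real.exp_mul, ← Real.exp_add]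
    ring_nf
  rw [ENNReal.mul_rpow_of_nonneg _ _ h1.le, ENNReal.mul_rpow_of_nonneg _ _ hs0.le,
    mul_mul_mul_comm, ENNReal.ofReal_rpow_of_pos (Real.exp_pos _),
    ENNReal.ofReal_rpow_of_pos (Real.exp_pos _), ← ENNReal.ofReal_mul (by positivity), ← hexp]
  gcongr
  rcases (superlevel w (Real.exp (-x))).eq_empty_or_nonempty with h0 | hx
  · simp [h0, ENNReal.zero_rpow_of_pos h1]
  rcases le_or_gt (volume (superlevel w (Real.exp (-y)))) l with h0 | hy
  · simp [tsub_eq_zero_of_le h0, ENNReal.zero_rpow_of_pos hs0]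
  have hyne : (superlevel w (Real.exp (-y))).Nonempty :=
    nonempty_of_measure_ne_zero (pos_of_gt hy).ne'
  refine (ENNReal.geom_mean_le_arith_mean2 hs0 hs1 _ _).trans ?_
  refine ENNReal.le_sub_of_add_le_right (ENNReal.mul_ne_top ENNReal.ofReal_ne_top hl) ?_
  rw [add_assoc, ← mul_add, tsub_add_cancel_of_le hy.le, hexp]
  exact volume_superlevel_comb hw hlog (Real.exp_pos _) (Real.exp_pos _) hs0 hs1 hx hyne

lemma volume_inter_superlevel_le (hw : Measurable w)
    (hlog : ∀ s : ℝ, 0 < s → s < 1 → ∀ x y, w x ^ (1 - s) * w y ^ s ≤ w ((1 - s) * x + s * y))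
    (hfin : ∀ t : ℝ, 0 < t → volume (superlevel w t) ≠ ∞) {E : Set ℝ} {κ h : ℝ} (hh : 0 < h)
    (hE : ∀ t, 0 < t → t < h →
      volume.real (E ∩ superlevel w t) ≤ κ * volume.real (superlevel w t))
    (hκ : 0 ≤ κ) :
    volume.real (E ∩ superlevel w h) ≤ κ * volume.real (superlevel w h) := by
  rcases (superlevel w h).eq_empty_or_nonempty with h0 | ⟨x₀, hx₀⟩
  · simp [h0]
  obtain ⟨t₀', ht₀, hx₀'⟩ := ENNReal.lt_iff_exists_nnreal_btwn.1 hx₀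
  set t₀ : ℝ := (t₀' : ℝ) with ht₀def
  have ht₀ : h < t₀ := by
    have := ENNReal.ofReal_lt_iff_lt_toReal hh.le ENNReal.coe_ne_top |>.1 ht₀
    simpa using this
  have hx₀' : (superlevel w t₀).Nonempty := ⟨x₀, by simpa [superlevel, t₀] using hx₀'⟩
  have ht₀0 : 0 < t₀ := hh.trans ht₀
  have key : ∀ s : ℝ, 0 < s → s < 1 →
      (1 - s) * volume.real (E ∩ superlevel w h) ≤ κ * volume.real (superlevel w h) := by
    intro s hs0 hs1
    have h1 : 0 < 1 - s := sub_pos.2 hs1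
    set t : ℝ := (h * t₀ ^ (-s)) ^ (1 - s)⁻¹ with ht
    have ht0 : 0 < t := by positivity
    have hts : t ^ (1 - s) * t₀ ^ s = h := by
      rw [ht, ← Real.rpow_mul (by positivity), inv_mul_cancel₀ h1.ne', Real.rpow_one, mul_assoc,
        ← Real.rpow_add ht₀0]
      simp
    have hth : t < h := by
      by_contra! hcon
      have : h ^ (1 - s) * h ^ s < t ^ (1 - s) * t₀ ^ s :=
        mul_lt_mul' (Real.rpow_le_rpow hh.le hcon h1.le) (Real.rpow_lt_rpow hh.le ht₀ hs0)
          (by positivity) (by positivity)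
      rw [hts, ← Real.rpow_add hh] at this
      simp at this
    have hsub := superlevel_anti (w := w) hth.le
    have hc := volume_superlevel_comb hw hlog ht0 ht₀0 hs0 hs1 ⟨x₀, hsub hx₀⟩ hx₀'
    rw [hts] at hc
    have hc' : (1 - s) * volume.real (superlevel w t) ≤ volume.real (superlevel w h) := by
      have := ENNReal.toReal_mono (hfin h hh) (le_self_add.trans hc)
      rwa [ENNReal.toReal_mul, ENNReal.toReal_ofReal h1.le] at this
    have hmono : volume.real (E ∩ superlevel w h) ≤ volume.real (E ∩ superlevel w t) :=
      measureReal_mono (inter_subset_inter_right _ hsub)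
        ((measure_mono inter_subset_right).trans_lt (hfin t ht0).lt_top).ne
    have := hmono.trans (hE t ht0 hth)
    nlinarith [mul_le_mul_of_nonneg_left hc' hκ, mul_le_mul_of_nonneg_left this h1.le]
  refine le_of_tendsto (x := 𝓝[>] (0 : ℝ)) (f := fun s => (1 - s) * volume.real (E ∩ superlevel w h)) ?_ ?_
  · have : Tendsto (fun s : ℝ => (1 - s) * volume.real (E ∩ superlevel w h)) (𝓝 0)
        (𝓝 ((1 - 0) * volume.real (E ∩ superlevel w h))) :=
      Continuous.tendsto (by fun_prop) _
    simpa using this.mono_left nhdsWithin_le_nhds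
  · filter_upwards [Ioo_mem_nhdsGT (zero_lt_one' ℝ)] with s hs
    exact key s hs.1 hs.2

/-- The one-dimensional dilation inequality for log-concave weights. -/
lemma rpow_lintegral_le_of_logConcave (hw : Measurable w)
    (hlog : ∀ s : ℝ, 0 < s → s < 1 → ∀ x y, w x ^ (1 - s) * w y ^ s ≤ w ((1 - s) * x + s * y))
    {R : ℝ} (hsupp : ∀ x, w x ≠ 0 → x ∈ Icc (-R) R) {M : ℝ≥0∞} (hM : M ≠ ∞) (hwM : ∀ x, w x ≤ M)
    {E G : Set ℝ} (hE : IsClosed E) (hG : IsClosed G) (hd : Disjoint E G)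
    {κ : ℝ} (hκ0 : 0 < κ) (hκ1 : κ < 1)
    (H : ∀ a b, (G ∩ Icc a b).Nonempty → volume.real (E ∩ Icc a b) ≤ κ * (b - a)) :
    (∫⁻ x, w x) ^ (1 - κ) * (∫⁻ x in G, w x) ^ κ ≤ ∫⁻ x in Eᶜ, w x := by
  have hfin : ∀ x, w x ≠ ∞ := fun x => ((hwM x).trans_lt hM.lt_top).ne
  have hsub : ∀ t, superlevel w t ⊆ Icc (-R) R := fun t x hx => hsupp x (pos_of_gt hx).ne'
  have hNfin : ∀ t, volume (superlevel w t) ≠ ∞ := fun t =>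
    ((measure_mono (hsub t)).trans_lt measure_Icc_lt_top).ne
  have hSfin : ∀ (S : Set ℝ) t, volume (S ∩ superlevel w t) ≠ ∞ := fun S t =>
    ((measure_mono inter_subset_right).trans_lt (hNfin t).lt_top).ne
  have hWfin : ∫⁻ x, w x ≠ ∞ := by
    have : ∫⁻ x, w x ≤ ∫⁻ x in Icc (-R) R, M := by
      rw [← lintegral_indicator measurableSet_Icc]
      refine lintegral_mono fun x => ?_
      by_cases hx : x ∈ Icc (-R) R
      · simpa [hx] using hwM x
      · have : w x = 0 := by
          by_contra h
          exact hx (hsupp x h)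
        simp [this]
    refine (this.trans_lt ?_).ne
    rw [setLIntegral_const]
    exact ENNReal.mul_lt_top hM.lt_top measure_Icc_lt_top
  have hcake : ∀ S : Set ℝ, MeasurableSet S →
      ∫⁻ x in S, w x = ∫⁻ t in Ioi (0 : ℝ), volume (S ∩ superlevel w t) := by
    intro S hS
    rw [lintegral_eq_lintegral_superlevel _ hw hfin]
    refine lintegral_congr fun t => ?_
    change (volume.restrict S) (superlevel w t) = _
    rw [Measure.restrict_apply (measurableSet_superlevel hw t), inter_comm]
  have hcake0 : ∫⁻ x, w x = ∫⁻ t in Ioi (0 : ℝ), volume (superlevel w t) := by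
    simpa using hcake univ MeasurableSet.univ
  have hsplit : ∀ (S : Set ℝ) t, MeasurableSet S →
      volume.real (S ∩ superlevel w t) + volume.real (Sᶜ ∩ superlevel w t) =
        volume.real (superlevel w t) := by
    intro S t hS
    rw [inter_comm S, inter_comm Sᶜ, ← Set.sdiff_eq]
    exact measureReal_inter_add_sdiff hS (hNfin t)
  have hGne : ∀ t, 0 < t → (G ∩ superlevel w t).Nonempty →
      volume.real (E ∩ superlevel w t) ≤
        κ * (volume.real (superlevel w t) - volume.real (G ∩ superlevel w t)) := by
    intro t ht hne
    have := volume_inter_le_mul_compl hE hG hd hκ0.le H (ordConnected_superlevel hlog ht)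
      (bddBelow_Icc.mono (hsub t)) (bddAbove_Icc.mono (hsub t)) hne
    rwa [← hsplit G t hG.measurableSet, add_sub_cancel_left]
  set h : ℝ := (⨆ x ∈ G, w x).toReal with hh
  have hsup : ⨆ x ∈ G, w x ≠ ∞ :=
    ((iSup₂_le fun x _ => hwM x).trans_lt hM.lt_top).ne
  have hGlt : ∀ t, 0 ≤ t → t < h → (G ∩ superlevel w t).Nonempty := by
    intro t ht0 ht
    have h1 := (ENNReal.ofReal_lt_iff_lt_toReal ht0 hsup).2 ht
    simp only [lt_iSup_iff] at h1
    obtain ⟨x, hx, hxt⟩ := h1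
    exact ⟨x, hx, hxt⟩
  have hGge : ∀ t, h ≤ t → G ∩ superlevel w t = ∅ := by
    intro t ht
    refine eq_empty_of_forall_notMem fun x hx => ?_
    have h1 : w x ≤ ENNReal.ofReal h := by
      rw [hh, ENNReal.ofReal_toReal hsup]
      exact le_iSup₂ (f := fun x _ => w x) x hx.1
    exact absurd hx.2 (not_lt.2 (h1.trans (ENNReal.ofReal_le_ofReal ht)))
  rcases (ENNReal.toReal_nonneg : 0 ≤ h).eq_or_lt with h0 | hpos
  · have : ∫⁻ x in G, w x = 0 := by
      rw [hcake G hG.measurableSet]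
      refine setLIntegral_eq_zero measurableSet_Ioi fun t ht => ?_
      have ht' : h ≤ t := by rw [hh, ← h0]; exact le_of_lt ht
      simp [hGge t ht']
    simp [this, ENNReal.zero_rpow_of_pos hκ0]
  set l : ℝ≥0∞ := volume (superlevel w h) with hl
  have hEl : volume.real (E ∩ superlevel w h) ≤ κ * l.toReal := by
    refine volume_inter_superlevel_le hw hlog (fun t _ => hNfin t) hpos (fun t ht hth => ?_) hκ0.le
    refine (hGne t ht (hGlt t ht.le hth)).trans ?_
    have : 0 ≤ volume.real (G ∩ superlevel w t) := measureReal_nonneg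
    nlinarith
  have hlfin : l ≠ ∞ := hNfin h
  have hGle : ∀ t, 0 < t → volume (G ∩ superlevel w t) ≤ volume (superlevel w t) - l := by
    intro t ht
    rcases lt_or_ge t h with hth | hth
    · rw [hl, ← measure_sdiff (superlevel_anti hth.le) (measurableSet_superlevel hw h).nullMeasurableSet
        (hNfin h)]
      refine measure_mono fun x hx => ⟨hx.2, fun hx' => ?_⟩
      have : x ∈ G ∩ superlevel w h := ⟨hx.1, hx'⟩
      simp [hGge h le_rfl] at this
    · simp [hGge t hth]
  have hptw : ∀ t, 0 < t → (volume (superlevel w t) - ENNReal.ofReal κ * l) +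
      ENNReal.ofReal κ * volume (G ∩ superlevel w t) ≤
      volume (Eᶜ ∩ superlevel w t) + ENNReal.ofReal κ * (volume (superlevel w t) - l) := by
    intro t ht
    have hs := hsplit E t hE.measurableSet
    have hκf : ENNReal.ofReal κ ≠ ∞ := ENNReal.ofReal_ne_top
    have hκl : ENNReal.ofReal κ * l ≠ ∞ := ENNReal.mul_ne_top hκf hlfin
    rcases lt_or_ge t h with hth | hth
    · have hlN : l ≤ volume (superlevel w t) := measure_mono (superlevel_anti hth.le)
      have hκlN : ENNReal.ofReal κ * l ≤ volume (superlevel w t) :=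
        le_trans (mul_le_of_le_one_left' (by simpa using hκ1.le)) hlN
      rw [← ENNReal.toReal_le_toReal
        (ENNReal.add_ne_top.2 ⟨ENNReal.sub_ne_top (hNfin t), ENNReal.mul_ne_top hκf (hSfin _ _)⟩)
        (ENNReal.add_ne_top.2 ⟨hSfin _ _, ENNReal.mul_ne_top hκf (ENNReal.sub_ne_top (hNfin t))⟩),
        ENNReal.toReal_add (ENNReal.sub_ne_top (hNfin t)) (ENNReal.mul_ne_top hκf (hSfin _ _)),
        ENNReal.toReal_add (hSfin _ _) (ENNReal.mul_ne_top hκf (ENNReal.sub_ne_top (hNfin t))),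
        ENNReal.toReal_sub_of_le hκlN (hNfin t), ENNReal.toReal_mul, ENNReal.toReal_mul,
        ENNReal.toReal_mul, ENNReal.toReal_sub_of_le hlN (hNfin t),
        ENNReal.toReal_ofReal hκ0.le]
      have := hGne t ht (hGlt t ht.le hth)
      simp only [Measure.real] at this hs
      linarith
    · have hNl : volume (superlevel w t) ≤ l := measure_mono (superlevel_anti hth)
      rw [hGge t hth, tsub_eq_zero_of_le hNl, measure_empty, mul_zero, add_zero, add_zero,
        tsub_le_iff_right]
      have h1 : volume.real (E ∩ superlevel w t) ≤ κ * l.toReal :=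
        (measureReal_mono (inter_subset_inter_right _ (superlevel_anti hth)) (hSfin _ _)).trans hEl
      rw [← ENNReal.toReal_le_toReal (hNfin t) (ENNReal.add_ne_top.2 ⟨hSfin _ _, hκl⟩),
        ENNReal.toReal_add (hSfin _ _) hκl, ENNReal.toReal_mul, ENNReal.toReal_ofReal hκ0.le]
      simp only [Measure.real] at h1 hs
      linarith
  have hN : Measurable fun t => volume (superlevel w t) :=
    Antitone.measurable fun t t' h => measure_mono (superlevel_anti h)
  have hSm : ∀ S : Set ℝ, Measurable fun t => volume (S ∩ superlevel w t) := fun S =>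
    Antitone.measurable fun t t' h => measure_mono (inter_subset_inter_right _ (superlevel_anti h))
  set W := ∫⁻ x, w x
  set p := ∫⁻ x in Eᶜ, w x
  set q := ∫⁻ x in G, w x
  set Q := ∫⁻ t in Ioi (0 : ℝ), (volume (superlevel w t) - l) with hQ
  set r := ∫⁻ t in Ioi (0 : ℝ), (volume (superlevel w t) - ENNReal.ofReal κ * l) with hr
  have hNsub : ∀ c : ℝ≥0∞, Measurable fun t => volume (superlevel w t) - c := fun c =>
    hN.sub measurable_const
  have hint : r + ENNReal.ofReal κ * q ≤ p + ENNReal.ofReal κ * Q := by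
    rw [hr, hQ, show q = _ from hcake G hG.measurableSet,
      show p = _ from hcake Eᶜ hE.measurableSet.compl,
      ← lintegral_const_mul _ (hSm G), ← lintegral_const_mul _ (hNsub l),
      ← lintegral_add_left (hNsub _), ← lintegral_add_left (hSm _)]
    exact setLIntegral_mono' measurableSet_Ioi hptw
  have hrW : W ^ (1 - κ) * Q ^ κ ≤ r := by
    have := lintegral_excess_logConcave hw hlog hκ0 hκ1 l hlfin
    rwa [← hcake0] at this
  have hqQ : q ≤ Q := by
    rw [hQ, show q = _ from hcake G hG.measurableSet]
    exact setLIntegral_mono' measurableSet_Ioi hGle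
  have hQW : Q ≤ W := by
    rw [hQ, show W = _ from hcake0]
    exact lintegral_mono fun t => tsub_le_self
  have hpW : p ≤ W := setLIntegral_le_lintegral _ _
  have hpf := (hpW.trans_lt hWfin.lt_top).ne
  have hQf := (hQW.trans_lt hWfin.lt_top).ne
  have hqf := (hqQ.trans_lt hQf.lt_top).ne
  have hκQ := ENNReal.mul_ne_top (ENNReal.ofReal_ne_top (r := κ)) hQf
  have hκq := ENNReal.mul_ne_top (ENNReal.ofReal_ne_top (r := κ)) hqf
  have hWQ : W ^ (1 - κ) * Q ^ κ ≠ ∞ := ENNReal.mul_ne_top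
    (ENNReal.rpow_ne_top_of_nonneg (by linarith) hWfin) (ENNReal.rpow_ne_top_of_nonneg hκ0.le hQf)
  have hWq : W ^ (1 - κ) * q ^ κ ≠ ∞ := ENNReal.mul_ne_top
    (ENNReal.rpow_ne_top_of_nonneg (by linarith) hWfin) (ENNReal.rpow_ne_top_of_nonneg hκ0.le hqf)
  have hfinal := ENNReal.toReal_mono (ENNReal.add_ne_top.2 ⟨hpf, hκQ⟩)
    ((add_le_add_left hrW _).trans hint)
  rw [ENNReal.toReal_add hWQ hκq, ENNReal.toReal_add hpf hκQ] at hfinal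
  rw [← ENNReal.toReal_le_toReal hWq hpf]
  simp only [ENNReal.toReal_mul, ← ENNReal.toReal_rpow, ENNReal.toReal_ofReal hκ0.le] at hfinal ⊢
  have := mul_sub_le_rpow_sub_rpow hκ0 hκ1.le ENNReal.toReal_nonneg
    (ENNReal.toReal_mono hQf hqQ) (ENNReal.toReal_mono hWfin hQW)
  linarith

end Dilation

lemma prod_abs_sub_eq_factorial_mul {d k : ℕ} (hk : k ≤ d) :
    ∏ j ∈ (Finset.range (d + 1)).erase k, |(k : ℝ) - j| = k.factorial * (d - k).factorial := by
  induction d, hk using Nat.le_induction with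
  | base =>
    have : (Finset.range (k + 1)).erase k = Finset.range k := by
      ext j; simp only [Finset.mem_erase, Finset.mem_range]; omega
    rw [this, ← Finset.prod_range_reflect, Nat.sub_self, Nat.factorial_zero, Nat.cast_one, mul_one,
      ← Finset.prod_range_add_one_eq_factorial]
    push_cast
    refine Finset.prod_congr rfl fun j hj => ?_
    have hj : j + 1 ≤ k := Finset.mem_range.1 hj
    rw [show k - 1 - j = k - (j + 1) by omega, Nat.cast_sub hj]
    push_cast
    rw [sub_sub_cancel, abs_of_nonneg (by positivity)]
  | succ d hkd ih =>
    have : (Finset.range (d + 1 + 1)).erase k = insert (d + 1) ((Finset.range (d + 1)).erase k) := by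
      ext j; simp only [Finset.mem_erase, Finset.mem_range, Finset.mem_insert]; omega
    rw [this, Finset.prod_insert (by simp), ih, Nat.succ_sub hkd, Nat.factorial_succ, abs_sub_comm]
    have : |((d + 1 : ℕ) : ℝ) - k| = ((d - k + 1 : ℕ) : ℝ) := by
      have : (k : ℝ) ≤ d := by exact_mod_cast hkd
      rw [Nat.cast_add (d - k), Nat.cast_sub hkd, abs_of_nonneg] <;> push_cast <;> linarith
    rw [this]
    push_cast
    ring

lemma sum_inv_factorial_mul (d : ℕ) :
    ∑ k ∈ Finset.range (d + 1), ((k.factorial : ℝ) * (d - k).factorial)⁻¹ =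
      2 ^ d / d.factorial := by
  rw [eq_div_iff (by positivity), Finset.sum_mul]
  have h := Nat.sum_range_choose d
  have h' : ∑ k ∈ Finset.range (d + 1), (d.choose k : ℝ) = 2 ^ d := by exact_mod_cast h
  rw [← h']
  refine Finset.sum_congr rfl fun k hk => ?_
  rw [Nat.cast_choose ℝ (Nat.lt_succ_iff.1 (Finset.mem_range.1 hk))]
  field_simp

/-- Points of `E` at which the distribution function of `E` takes a prescribed value. -/
lemma exists_mem_volume_inter_Icc_eq {E : Set ℝ} (hE : IsClosed E) {a b : ℝ}
    (hm : 0 < volume.real (E ∩ Icc a b)) {s : ℝ} (hs0 : 0 ≤ s)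
    (hs : s ≤ volume.real (E ∩ Icc a b)) :
    ∃ t ∈ E ∩ Icc a b, volume.real (E ∩ Icc a t) = s := by
  have hne : (E ∩ Icc a b).Nonempty := by
    by_contra h
    rw [not_nonempty_iff_eq_empty.1 h] at hm
    simp at hm
  have hcpt : ∀ z, IsCompact (E ∩ Icc a z) := fun z => isCompact_Icc.inter_left hE
  have hab : a ≤ b := by
    obtain ⟨x, hx⟩ := hne
    exact hx.2.1.trans hx.2.2
  have hlip : ∀ y ∈ Icc a b, ∀ z ∈ Icc a b, y ≤ z →
      |volume.real (E ∩ Icc a z) - volume.real (E ∩ Icc a y)| ≤ z - y := by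
    intro y hy z hz hyz
    rw [volume_real_inter_Icc_add hy.1 hyz, add_sub_cancel_left, abs_of_nonneg measureReal_nonneg,
      ← Real.volume_real_Icc_of_le hyz]
    exact measureReal_mono inter_subset_right measure_Icc_lt_top.ne
  have hcont : ContinuousOn (fun z => volume.real (E ∩ Icc a z)) (Icc a b) := by
    refine (LipschitzOnWith.of_dist_le_mul (K := 1) fun y hy z hz => ?_).continuousOn
    rw [NNReal.coe_one, one_mul, Real.dist_eq, Real.dist_eq]
    rcases le_total y z with h | h
    · rw [abs_sub_comm, abs_sub_comm y, abs_of_nonneg (sub_nonneg.2 h)]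
      exact hlip y hy z hz h
    · rw [abs_of_nonneg (sub_nonneg.2 h)]
      exact hlip z hz y hy h
  have hnull : ∀ x : ℝ, volume.real (E ∩ Icc x x) = 0 := by
    intro x
    rw [Icc_self, measureReal_def, measure_mono_null inter_subset_right Real.volume_singleton]
    rfl
  obtain ⟨z, hz, hzs⟩ := intermediate_value_Icc hab hcont
    (show s ∈ Icc _ _ from ⟨by simp only [hnull a]; exact hs0, hs⟩)
  rcases (E ∩ Icc a z).eq_empty_or_nonempty with h0 | h0
  · obtain ⟨t, ht, hmin⟩ := (hcpt b).exists_isLeast hne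
    refine ⟨t, ht, ?_⟩
    have : s = 0 := by rw [← hzs]; simp [h0]
    rw [this, ← hnull t]
    congr 1
    refine Subset.antisymm (fun x hx => ⟨hx.1, hmin ⟨hx.1, hx.2.1, hx.2.2.trans ht.2.2⟩, hx.2.2⟩) ?_
    exact fun x hx => ⟨hx.1, ht.2.1.trans hx.2.1, hx.2.2⟩
  · obtain ⟨t, ht, hmax⟩ := (hcpt z).exists_isGreatest h0
    refine ⟨t, ⟨ht.1, ht.2.1, ht.2.2.trans hz.2⟩, ?_⟩
    rw [← hzs]
    congr 1
    refine Subset.antisymm (fun x hx => ⟨hx.1, hx.2.1, hx.2.2.trans ht.2.2⟩) ?_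
    exact fun x hx => ⟨hx.1, hx.2.1, hmax hx⟩

/-- A Remez type inequality. -/
lemma abs_eval_le_of_abs_eval_le {Q : Polynomial ℝ} {d : ℕ} (hd : 1 ≤ d) (hQ : Q.natDegree ≤ d)
    {E : Set ℝ} (hE : IsClosed E) {c : ℝ} (hc : ∀ x ∈ E, |Q.eval x| ≤ c) {a b : ℝ}
    (hm : 0 < volume.real (E ∩ Icc a b)) {x : ℝ} (hx : x ∈ Icc a b) :
    |Q.eval x| ≤ (2 * Real.exp 1 * ((b - a) / volume.real (E ∩ Icc a b))) ^ d * c := by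
  set m := volume.real (E ∩ Icc a b) with hmdef
  have hd0 : (0 : ℝ) < d := by exact_mod_cast hd
  have hnode : ∀ k : ℕ, ∃ t : ℝ, k ≤ d → t ∈ E ∩ Icc a b ∧ volume.real (E ∩ Icc a t) = k * m / d := by
    intro k
    by_cases hk : k ≤ d
    · obtain ⟨t, ht, h⟩ := exists_mem_volume_inter_Icc_eq hE hm (s := k * m / d) (by positivity) (by
        rw [div_le_iff₀ hd0, mul_comm]
        gcongr)
      exact ⟨t, fun _ => ⟨ht, h⟩⟩
    · exact ⟨0, fun h => absurd h hk⟩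
  choose t ht using hnode
  have hba : 0 ≤ b - a := by linarith [hx.1, hx.2]
  have hsep' : ∀ j ≤ d, ∀ k ≤ d, t j ≤ t k → |(k : ℝ) - j| * (m / d) ≤ |t k - t j| := by
    intro j hj k hk hjk
    have h1 := volume_real_inter_Icc_add (S := E) (ht j hj).1.2.1 hjk
    rw [(ht j hj).2, (ht k hk).2] at h1
    have h2 : volume.real (E ∩ Icc (t j) (t k)) ≤ t k - t j := by
      rw [← Real.volume_real_Icc_of_le hjk]
      exact measureReal_mono inter_subset_right measure_Icc_lt_top.ne
    have h3 : 0 ≤ volume.real (E ∩ Icc (t j) (t k)) := measureReal_nonneg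
    have h4 : ((k : ℝ) - j) * (m / d) = volume.real (E ∩ Icc (t j) (t k)) := by
      have : (k : ℝ) * m / d - j * m / d = ((k : ℝ) - j) * (m / d) := by ring
      linarith
    rw [abs_of_nonneg (sub_nonneg.2 hjk), ← abs_of_pos (div_pos hm hd0), ← abs_mul, h4,
      abs_of_nonneg h3]
    exact h2
  have hsep : ∀ j ≤ d, ∀ k ≤ d, |(k : ℝ) - j| * (m / d) ≤ |t k - t j| := by
    intro j hj k hk
    rcases le_total (t j) (t k) with h | h
    · exact hsep' j hj k hk h
    · rw [abs_sub_comm, abs_sub_comm (t k)]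
      exact hsep' k hk j hj h
  have hinj : Set.InjOn t (Finset.range (d + 1)) := by
    intro j hj k hk hjk
    have hj : j ≤ d := by simpa [Nat.lt_succ_iff] using hj
    have hk : k ≤ d := by simpa [Nat.lt_succ_iff] using hk
    have := hsep j hj k hk
    rw [hjk, sub_self, abs_zero] at this
    have h0 : |(k : ℝ) - j| = 0 :=
      le_antisymm (by_contra fun h => absurd this (not_le.2 (mul_pos (not_le.1 h) (div_pos hm hd0))))
        (abs_nonneg _)
    have : (k : ℝ) = j := by linarith [abs_eq_zero.1 h0]
    exact_mod_cast this.symm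
  have hinterp := Lagrange.eq_interpolate (f := Q) (v := t) (s := Finset.range (d + 1)) hinj (by
    rw [Finset.card_range]
    exact (Polynomial.degree_le_natDegree).trans_lt (by exact_mod_cast Nat.lt_succ_of_le hQ))
  have hc0 : 0 ≤ c := (abs_nonneg _).trans (hc _ (ht 0 (Nat.zero_le d)).1.1)
  have hbasis : ∀ k ∈ Finset.range (d + 1),
      |(Lagrange.basis (Finset.range (d + 1)) t k).eval x| ≤
        ((b - a) * d / m) ^ d * ((k.factorial : ℝ) * (d - k).factorial)⁻¹ := by
    intro k hk
    have hkd : k ≤ d := Nat.lt_succ_iff.1 (Finset.mem_range.1 hk)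
    rw [Lagrange.basis, Polynomial.eval_prod, Finset.abs_prod]
    calc ∏ j ∈ (Finset.range (d + 1)).erase k, |(Lagrange.basisDivisor (t k) (t j)).eval x|
        ≤ ∏ j ∈ (Finset.range (d + 1)).erase k, ((b - a) * d / m * |(k : ℝ) - j|⁻¹) := by
          refine Finset.prod_le_prod (fun j _ => abs_nonneg _) fun j hj => ?_
          obtain ⟨hjk, hj⟩ := Finset.mem_erase.1 hj
          have hjd : j ≤ d := Nat.lt_succ_iff.1 (Finset.mem_range.1 hj)
          have hpos : 0 < |(k : ℝ) - j| := abs_pos.2 (sub_ne_zero.2 (by exact_mod_cast hjk.symm))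
          have hs := hsep j hjd k hkd
          have htj := (ht j hjd).1.2
          have hxa : |x - t j| ≤ b - a := by
            rw [abs_le]; constructor <;> linarith [hx.1, hx.2, htj.1, htj.2]
          simp only [Lagrange.basisDivisor, Polynomial.eval_mul, Polynomial.eval_C,
            Polynomial.eval_sub, Polynomial.eval_X, abs_mul, abs_inv]
          calc |t k - t j|⁻¹ * |x - t j| ≤ (|(k : ℝ) - j| * (m / d))⁻¹ * (b - a) := by gcongr
            _ = _ := by field_simp
      _ = _ := by
          rw [Finset.prod_mul_distrib, Finset.prod_const, Finset.card_erase_of_mem hk,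
            Finset.card_range, Finset.prod_inv_distrib, prod_abs_sub_eq_factorial_mul hkd,
            Nat.add_sub_cancel]
  have hexp : (d : ℝ) ^ d / d.factorial ≤ Real.exp 1 ^ d := by
    rw [← Real.exp_nat_mul, mul_one]
    exact Real.pow_div_factorial_le_exp _ hd0.le d
  calc |Q.eval x| = |∑ k ∈ Finset.range (d + 1), Q.eval (t k) *
        (Lagrange.basis (Finset.range (d + 1)) t k).eval x| := by
        conv_lhs => rw [hinterp]
        simp [Lagrange.interpolate_apply, Polynomial.eval_finsetSum]
    _ ≤ ∑ k ∈ Finset.range (d + 1), c *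
        (((b - a) * d / m) ^ d * ((k.factorial : ℝ) * (d - k).factorial)⁻¹) := by
        refine (Finset.abs_sum_le_sum_abs _ _).trans (Finset.sum_le_sum fun k hk => ?_)
        rw [abs_mul]
        have hkd : k ≤ d := Nat.lt_succ_iff.1 (Finset.mem_range.1 hk)
        exact mul_le_mul (hc _ (ht k hkd).1.1) (hbasis k hk) (abs_nonneg _) hc0
    _ = c * ((2 * ((b - a) / m)) ^ d * ((d : ℝ) ^ d / d.factorial)) := by
        rw [← Finset.mul_sum, ← Finset.mul_sum, sum_inv_factorial_mul, mul_div_right_comm (b - a),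
          mul_pow, mul_pow 2]
        ring
    _ ≤ c * ((2 * ((b - a) / m)) ^ d * Real.exp 1 ^ d) := by gcongr
    _ = _ := by rw [← mul_pow, mul_comm c]; ring

lemma rpow_lintegral_polynomial_le {w : ℝ → ℝ≥0∞} (hw : Measurable w)
    (hlog : ∀ s : ℝ, 0 < s → s < 1 → ∀ x y, w x ^ (1 - s) * w y ^ s ≤ w ((1 - s) * x + s * y))
    {R : ℝ} (hsupp : ∀ x, w x ≠ 0 → x ∈ Icc (-R) R) {M : ℝ≥0∞} (hM : M ≠ ∞) (hwM : ∀ x, w x ≤ M)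
    {Q : Polynomial ℝ} {d : ℕ} (hd : 1 ≤ d) (hQ : Q.natDegree ≤ d) {l c : ℝ} (hl : 1 < l)
    (hc : 0 < c) :
    (∫⁻ x, w x) ^ (1 - l⁻¹) *
      (∫⁻ x in {x | (2 * Real.exp 1 * l) ^ d * c ≤ |Q.eval x|}, w x) ^ l⁻¹ ≤
      ∫⁻ x in {x | c < |Q.eval x|}, w x := by
  have hl0 : 0 < l := by linarith
  have hcont : Continuous fun x => |Q.eval x| := by fun_prop
  have hE : IsClosed {x | |Q.eval x| ≤ c} := isClosed_le hcont continuous_const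
  have hcompl : {x | c < |Q.eval x|} = {x | |Q.eval x| ≤ c}ᶜ := by ext x; simp
  have he : 2 ≤ Real.exp 1 := by linarith [Real.add_one_le_exp 1]
  have hbig : 1 < (2 * Real.exp 1 * l) ^ d := one_lt_pow₀ (by nlinarith) (by omega)
  rw [hcompl]
  refine rpow_lintegral_le_of_logConcave hw hlog hsupp hM hwM hE
    (isClosed_le continuous_const hcont) ?_ (inv_pos.2 hl0) (inv_lt_one_of_one_lt₀ hl) ?_
  · refine disjoint_left.2 fun x hx hx' => ?_
    have h1 : |Q.eval x| ≤ c := hx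
    have h2 : (2 * Real.exp 1 * l) ^ d * c ≤ |Q.eval x| := hx'
    nlinarith
  · rintro a b ⟨x, hxG, hx⟩
    by_contra! hlt
    have hba : 0 ≤ b - a := by linarith [hx.1, hx.2]
    have hm := (mul_nonneg (inv_pos.2 hl0).le hba).trans_lt hlt
    have h := abs_eval_le_of_abs_eval_le hd hQ hE (fun x hx => hx) hm hx
    have h2 : (2 * Real.exp 1 * l) ^ d * c ≤ |Q.eval x| := hxG
    have h3 : (b - a) / volume.real ({x | |Q.eval x| ≤ c} ∩ Icc a b) < l := by
      rw [div_lt_iff₀ hm]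
      rwa [inv_mul_lt_iff₀ hl0] at hlt
    have h4 : (2 * Real.exp 1 * ((b - a) / volume.real ({x | |Q.eval x| ≤ c} ∩ Icc a b))) ^ d <
        (2 * Real.exp 1 * l) ^ d := by
      refine pow_lt_pow_left₀ ?_ (by positivity) (by omega)
      gcongr
    nlinarith [mul_lt_mul_of_pos_right h4 hc]

lemma volume_setOf_linear_eq_zero {n : ℕ} {i j : Fin n} (hij : i ≠ j) {α β : ℝ}
    (h : ¬(α = 0 ∧ β = 0)) (p q : ℝ) :
    volume {x : Fin n → ℝ | α * (x i - p) + β * (x j - q) = 0} = 0 := by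
  rcases {x : Fin n → ℝ | α * (x i - p) + β * (x j - q) = 0}.eq_empty_or_nonempty with h0 | ⟨x₀, hx₀⟩
  · simp [h0]
  let L : (Fin n → ℝ) →ₗ[ℝ] ℝ := α • LinearMap.proj i + β • LinearMap.proj j
  have hL : LinearMap.ker L ≠ ⊤ := by
    intro hk
    have h1 : ∀ x, L x = 0 := fun x => by
      have : x ∈ LinearMap.ker L := hk ▸ Submodule.mem_top
      simpa using this
    have hi := h1 (Pi.single i 1)
    have hj := h1 (Pi.single j 1)
    simp [L, hij, hij.symm] at hi hj
    exact h ⟨hi, hj⟩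
  have heq : {x : Fin n → ℝ | α * (x i - p) + β * (x j - q) = 0} =
      (fun x => -x₀ + x) ⁻¹' (LinearMap.ker L : Set (Fin n → ℝ)) := by
    ext x
    have h2 : α * (x₀ i - p) + β * (x₀ j - q) = 0 := hx₀
    simp only [mem_ofPred_eq, mem_preimage, SetLike.mem_coe, LinearMap.mem_ker, L,
      LinearMap.add_apply, LinearMap.smul_apply, LinearMap.proj_apply, Pi.add_apply, Pi.neg_apply,
      smul_eq_mul]
    constructor <;> intro h <;> linarith
  rw [heq, measure_preimage_add]
  exact Measure.addHaar_submodule _ _ hL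

lemma exists_bisection {n : ℕ} {K : Set (Fin n → ℝ)} (hK : IsCompact K) (hKc : Convex ℝ K)
    {g₁ g₂ : (Fin n → ℝ) → ℝ} (hg₁ : IntegrableOn g₁ K) (hg₂ : IntegrableOn g₂ K)
    (h₁ : 0 < ∫ x in K, g₁ x) (h₂ : 0 ≤ ∫ x in K, g₂ x) {i j : Fin n} (hij : i ≠ j) (p q : ℝ) :
    ∃ K' ⊆ K, IsCompact K' ∧ Convex ℝ K' ∧ 0 < ∫ x in K', g₁ x ∧ 0 ≤ ∫ x in K', g₂ x ∧
      ∃ α β : ℝ, ¬(α = 0 ∧ β = 0) ∧ ∀ x ∈ K', 0 ≤ α * (x i - p) + β * (x j - q) := by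
  let h : ℝ → (Fin n → ℝ) → ℝ := fun θ x => Real.cos θ * (x i - p) + Real.sin θ * (x j - q)
  have hcont : Continuous fun z : ℝ × (Fin n → ℝ) => h z.1 z.2 := by fun_prop
  have hcontx : ∀ θ, Continuous (h θ) := fun θ => by fun_prop
  have hcontθ : ∀ x, Continuous fun θ => h θ x := fun x => by fun_prop
  have hcs : ∀ θ, ¬(Real.cos θ = 0 ∧ Real.sin θ = 0) := by
    rintro θ ⟨h1, h2⟩
    have := Real.sin_sq_add_cos_sq θ
    simp [h1, h2] at this
  have hnull : ∀ θ, volume {x | h θ x = 0} = 0 := fun θ =>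
    volume_setOf_linear_eq_zero hij (hcs θ) p q
  have hmeas : ∀ θ, MeasurableSet {x | 0 ≤ h θ x} := fun θ =>
    (isClosed_le continuous_const (hcontx θ)).measurableSet
  have hpi : ∀ θ x, h (θ + Real.pi) x = - h θ x := by
    intro θ x
    simp only [h, Real.cos_add_pi, Real.sin_add_pi]
    ring
  have hsum : ∀ (g : (Fin n → ℝ) → ℝ), IntegrableOn g K → ∀ θ,
      (∫ x in K ∩ {x | 0 ≤ h θ x}, g x) + ∫ x in K ∩ {x | 0 ≤ h (θ + Real.pi) x}, g x =
        ∫ x in K, g x := by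
    intro g hg θ
    rw [← integral_inter_add_sdiff (hmeas θ) hg]
    congr 1
    refine setIntegral_congr_set ?_
    rw [sdiff_eq]
    refine (ae_eq_refl K).inter (Filter.eventuallyLE_antisymm_iff.2 ⟨?_, ?_⟩)
    · have : ∀ᵐ x ∂volume, h θ x ≠ 0 := by
        rw [ae_iff]; simpa using hnull θ
      filter_upwards [this] with x hx hx' hcon
      have h1 : 0 ≤ h (θ + Real.pi) x := hx'
      have h2 : 0 ≤ h θ x := hcon
      rw [hpi] at h1
      exact hx (by linarith)
    · refine Eventually.of_forall fun x hx => ?_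
      have h2 : ¬ 0 ≤ h θ x := hx
      show 0 ≤ h (θ + Real.pi) x
      rw [hpi]
      linarith
  let f : ℝ → ℝ := fun θ => ∫ x in K ∩ {x | 0 ≤ h θ x}, g₁ x
  have hf : Continuous f := by
    have hfe : f = fun θ => ∫ x in K, {x | 0 ≤ h θ x}.indicator g₁ x := by
      funext θ
      rw [setIntegral_indicator (hmeas θ)]
    rw [hfe, continuous_iff_continuousAt]
    intro θ
    refine continuousAt_of_dominated (bound := fun x => ‖g₁ x‖)
      (Eventually.of_forall fun θ' => hg₁.aestronglyMeasurable.indicator (hmeas θ'))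
      (Eventually.of_forall fun θ' => Eventually.of_forall fun x => norm_indicator_le_norm_self _ _)
      hg₁.norm ?_
    have : ∀ᵐ x ∂(volume.restrict K), h θ x ≠ 0 := by
      refine ae_restrict_of_ae ?_
      rw [ae_iff]; simpa using hnull θ
    filter_upwards [this] with x hx
    rcases hx.lt_or_gt with hx | hx
    · refine (continuousAt_const (y := (0 : ℝ))).congr ?_
      filter_upwards [(hcontθ x).continuousAt.eventually_lt continuousAt_const hx] with θ' hθ'
      rw [indicator_of_notMem]
      exact not_le.2 hθ'
    · refine (continuousAt_const (y := g₁ x)).congr ?_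
      filter_upwards [continuousAt_const.eventually_lt (hcontθ x).continuousAt hx] with θ' hθ'
      rw [indicator_of_mem]
      exact hθ'.le
  have hivt : ∃ θ, f θ = (∫ x in K, g₁ x) / 2 := by
    have h0 := hsum g₁ hg₁ 0
    rw [zero_add] at h0
    have h0' : f 0 + f Real.pi = ∫ x in K, g₁ x := h0
    rcases le_total (f 0) (f Real.pi) with hle | hle
    · obtain ⟨θ, -, hθ⟩ := intermediate_value_Icc Real.pi_pos.le hf.continuousOn
        (show (∫ x in K, g₁ x) / 2 ∈ Icc _ _ from ⟨by linarith, by linarith⟩)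
      exact ⟨θ, hθ⟩
    · obtain ⟨θ, -, hθ⟩ := intermediate_value_Icc' Real.pi_pos.le hf.continuousOn
        (show (∫ x in K, g₁ x) / 2 ∈ Icc _ _ from ⟨by linarith, by linarith⟩)
      exact ⟨θ, hθ⟩
  obtain ⟨θ, hθ⟩ := hivt
  have hgood : ∀ θ', f θ' = (∫ x in K, g₁ x) / 2 → 0 ≤ ∫ x in K ∩ {x | 0 ≤ h θ' x}, g₂ x →
      ∃ K' ⊆ K, IsCompact K' ∧ Convex ℝ K' ∧ 0 < ∫ x in K', g₁ x ∧ 0 ≤ ∫ x in K', g₂ x ∧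
      ∃ α β : ℝ, ¬(α = 0 ∧ β = 0) ∧ ∀ x ∈ K', 0 ≤ α * (x i - p) + β * (x j - q) := by
    intro θ' h1 h2
    refine ⟨K ∩ {x | 0 ≤ h θ' x}, inter_subset_left,
      hK.inter_right (isClosed_le continuous_const (hcontx θ')), hKc.inter ?_, ?_, h2,
      Real.cos θ', Real.sin θ', hcs θ', fun x hx => hx.2⟩
    · intro x hx y hy a b ha hb hab
      have hx : 0 ≤ h θ' x := hx
      have hy : 0 ≤ h θ' y := hy
      show 0 ≤ h θ' (a • x + b • y)
      have : h θ' (a • x + b • y) = a * h θ' x + b * h θ' y := by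
        simp only [h, Pi.add_apply, Pi.smul_apply, smul_eq_mul]
        have hb' : b = 1 - a := by linarith
        rw [hb']
        ring
      rw [this]
      positivity
    · have : f θ' = ∫ x in K ∩ {x | 0 ≤ h θ' x}, g₁ x := rfl
      linarith
  rcases le_or_gt 0 (∫ x in K ∩ {x | 0 ≤ h θ x}, g₂ x) with h0 | h0
  · exact hgood θ hθ h0
  · refine hgood (θ + Real.pi) ?_ ?_
    · have : f θ + f (θ + Real.pi) = ∫ x in K, g₁ x := hsum g₁ hg₁ θ
      linarith
    · linarith [hsum g₂ hg₂ θ]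

/-- Three points satisfying, for each rational point `p` of a coordinate plane, a common linear
inequality through `p`, have collinear projections to this plane. -/
lemma det_eq_zero_of_forall_rat {x y z : ℝ × ℝ}
    (h : ∀ p : ℚ × ℚ, ∃ α β : ℝ, ¬(α = 0 ∧ β = 0) ∧ 0 ≤ α * (x.1 - p.1) + β * (x.2 - p.2) ∧
      0 ≤ α * (y.1 - p.1) + β * (y.2 - p.2) ∧ 0 ≤ α * (z.1 - p.1) + β * (z.2 - p.2)) :
    (y.1 - x.1) * (z.2 - x.2) - (y.2 - x.2) * (z.1 - x.1) = 0 := by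
  by_contra hD
  set D := (y.1 - x.1) * (z.2 - x.2) - (y.2 - x.2) * (z.1 - x.1) with hDdef
  let s : ℝ × ℝ → ℝ := fun p => ((p.1 - x.1) * (z.2 - x.2) - (p.2 - x.2) * (z.1 - x.1)) / D
  let t : ℝ × ℝ → ℝ := fun p => ((y.1 - x.1) * (p.2 - x.2) - (y.2 - x.2) * (p.1 - x.1)) / D
  have hs : Continuous s := by fun_prop
  have ht : Continuous t := by fun_prop
  have hopen : IsOpen {p | 0 < s p ∧ 0 < t p ∧ s p + t p < 1} :=
    (isOpen_lt continuous_const hs).inter ((isOpen_lt continuous_const ht).inter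
      (isOpen_lt (hs.add ht) continuous_const))
  have hne : {p | 0 < s p ∧ 0 < t p ∧ s p + t p < 1}.Nonempty := by
    refine ⟨(x.1 + (y.1 - x.1) / 3 + (z.1 - x.1) / 3, x.2 + (y.2 - x.2) / 3 + (z.2 - x.2) / 3), ?_⟩
    have h1 : s (x.1 + (y.1 - x.1) / 3 + (z.1 - x.1) / 3, x.2 + (y.2 - x.2) / 3 + (z.2 - x.2) / 3)
        = 1 / 3 := by
      simp only [s]
      rw [div_eq_iff hD, hDdef]
      ring
    have h2 : t (x.1 + (y.1 - x.1) / 3 + (z.1 - x.1) / 3, x.2 + (y.2 - x.2) / 3 + (z.2 - x.2) / 3)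
        = 1 / 3 := by
      simp only [t]
      rw [div_eq_iff hD, hDdef]
      ring
    simp only [mem_ofPred_eq, h1, h2]
    norm_num
  have hdense : DenseRange (Prod.map ((↑) : ℚ → ℝ) ((↑) : ℚ → ℝ)) :=
    Rat.denseRange_cast.prodMap Rat.denseRange_cast
  obtain ⟨p, hps, hpt, hpst⟩ := hdense.exists_mem_open hopen hne
  obtain ⟨α, β, hαβ, hx, hy, hz⟩ := h p
  set s' := s (Prod.map (↑) (↑) p) with hs'
  set t' := t (Prod.map (↑) (↑) p) with ht'
  have e1 : (p.1 : ℝ) = x.1 + s' * (y.1 - x.1) + t' * (z.1 - x.1) := by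
    simp only [hs', ht', s, t, Prod.map]
    field_simp
    rw [hDdef]
    ring
  have e2 : (p.2 : ℝ) = x.2 + s' * (y.2 - x.2) + t' * (z.2 - x.2) := by
    simp only [hs', ht', s, t, Prod.map]
    field_simp
    rw [hDdef]
    ring
  have hsum : (1 - s' - t') * (α * (x.1 - p.1) + β * (x.2 - p.2)) +
      s' * (α * (y.1 - p.1) + β * (y.2 - p.2)) + t' * (α * (z.1 - p.1) + β * (z.2 - p.2)) = 0 := by
    rw [e1, e2]
    ring
  have hr : 0 < 1 - s' - t' := by linarith
  have h1 := mul_nonneg hr.le hx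
  have h2 := mul_nonneg hps.le hy
  have h3 := mul_nonneg hpt.le hz
  have h1' := (mul_eq_zero.1 (show (1 - s' - t') * (α * (x.1 - p.1) + β * (x.2 - p.2)) = (0 : ℝ) by
    linarith)).resolve_left hr.ne'
  have h2' := (mul_eq_zero.1 (show s' * (α * (y.1 - p.1) + β * (y.2 - p.2)) = (0 : ℝ) by
    linarith)).resolve_left hps.ne'
  have h3' := (mul_eq_zero.1 (show t' * (α * (z.1 - p.1) + β * (z.2 - p.2)) = (0 : ℝ) by
    linarith)).resolve_left hpt.ne'
  have hu : α * (y.1 - x.1) + β * (y.2 - x.2) = 0 := by linarith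
  have hv : α * (z.1 - x.1) + β * (z.2 - x.2) = 0 := by linarith
  refine hαβ ⟨?_, ?_⟩
  · refine (mul_eq_zero.1 (show α * D = 0 from ?_)).resolve_right hD
    rw [hDdef]
    linear_combination (z.2 - x.2) * hu - (y.2 - x.2) * hv
  · refine (mul_eq_zero.1 (show β * D = 0 from ?_)).resolve_right hD
    rw [hDdef]
    linear_combination (y.1 - x.1) * hv - (z.1 - x.1) * hu

/-- A localization lemma: two integral inequalities on a compact convex set can be restricted to a
compact convex subset on which a continuous function is almost a function on a line. -/
lemma exists_localization {n : ℕ} {F : Set (Fin (n + 1) → ℝ)} (hF : IsCompact F)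
    (hFc : Convex ℝ F) {g₁ g₂ : (Fin (n + 1) → ℝ) → ℝ} (hg₁ : IntegrableOn g₁ F)
    (hg₂ : IntegrableOn g₂ F) (h₁ : 0 < ∫ x in F, g₁ x) (h₂ : 0 ≤ ∫ x in F, g₂ x)
    {φ : (Fin (n + 1) → ℝ) → ℝ} (hφ : Continuous φ) {ω : ℝ} (hω : 0 < ω) :
    ∃ K ⊆ F, IsCompact K ∧ Convex ℝ K ∧ 0 < ∫ x in K, g₁ x ∧ 0 ≤ ∫ x in K, g₂ x ∧
      ∃ (i : Fin (n + 1)) (a v : Fin (n + 1) → ℝ), v i = 1 ∧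
        ∀ x ∈ K, |φ x - φ (a + (x i - a i) • v)| < ω := by
  let Good : Set (Fin (n + 1) → ℝ) → Prop := fun K =>
    K ⊆ F ∧ IsCompact K ∧ Convex ℝ K ∧ 0 < ∫ x in K, g₁ x ∧ 0 ≤ ∫ x in K, g₂ x
  have hstep : ∀ (K : {K // Good K}) (e : (Fin (n + 1) × Fin (n + 1)) × (ℚ × ℚ)),
      ∃ K' : {K // Good K}, K'.1 ⊆ K.1 ∧ (e.1.1 ≠ e.1.2 → ∃ α β : ℝ, ¬(α = 0 ∧ β = 0) ∧
        ∀ x ∈ K'.1, 0 ≤ α * (x e.1.1 - e.2.1) + β * (x e.1.2 - e.2.2)) := by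
    rintro ⟨K, hKF, hK, hKc, hK1, hK2⟩ ⟨⟨i, j⟩, p, q⟩
    by_cases hij : i = j
    · exact ⟨⟨K, hKF, hK, hKc, hK1, hK2⟩, Subset.rfl, fun h => absurd hij h⟩
    · obtain ⟨K', hK'K, hK', hKc', hK1', hK2', h⟩ := exists_bisection hK hKc (hg₁.mono_set hKF)
        (hg₂.mono_set hKF) hK1 hK2 hij p q
      exact ⟨⟨K', hK'K.trans hKF, hK', hKc', hK1', hK2'⟩, hK'K, fun _ => h⟩
  choose next hnext hcut using hstep
  obtain ⟨e, he⟩ := exists_surjective_nat ((Fin (n + 1) × Fin (n + 1)) × (ℚ × ℚ))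
  let S : ℕ → {K // Good K} := fun k =>
    Nat.rec ⟨F, Subset.rfl, hF, hFc, h₁, h₂⟩ (fun k K => next K (e k)) k
  have hS : ∀ k, S (k + 1) = next (S k) (e k) := fun k => rfl
  have hanti : Antitone fun k => (S k).1 := antitone_nat_of_succ_le fun k => by
    rw [hS]
    exact hnext _ _
  have hne : ∀ k, (S k).1.Nonempty := by
    intro k
    by_contra h
    have := (S k).2.2.2.2.1
    rw [not_nonempty_iff_eq_empty.1 h] at this
    simp at this
  have hcpt : ∀ k, IsCompact (S k).1 := fun k => (S k).2.2.1
  obtain ⟨x₀, hx₀⟩ := IsCompact.nonempty_iInter_of_sequence_nonempty_isCompact_isClosed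
    (fun k => (S k).1) (fun k => hanti (Nat.le_succ k)) hne (hcpt 0) fun k => (hcpt k).isClosed
  have hdet : ∀ y ∈ ⋂ k, (S k).1, ∀ z ∈ ⋂ k, (S k).1, ∀ i j, i ≠ j →
      (y i - x₀ i) * (z j - x₀ j) - (y j - x₀ j) * (z i - x₀ i) = 0 := by
    intro y hy z hz i j hij
    refine det_eq_zero_of_forall_rat (x := (x₀ i, x₀ j)) (y := (y i, y j)) (z := (z i, z j))
      fun p => ?_
    obtain ⟨k, hk⟩ := he ((i, j), p)
    have := hcut (S k) (e k)
    rw [← hS, hk] at this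
    obtain ⟨α, β, hαβ, h⟩ := this hij
    exact ⟨α, β, hαβ, h _ (mem_iInter.1 hx₀ (k + 1)), h _ (mem_iInter.1 hy (k + 1)),
      h _ (mem_iInter.1 hz (k + 1))⟩
  have hline : ∃ (i : Fin (n + 1)) (v : Fin (n + 1) → ℝ), v i = 1 ∧
      ∀ z ∈ ⋂ k, (S k).1, z = x₀ + (z i - x₀ i) • v := by
    by_cases hone : ∀ z ∈ ⋂ k, (S k).1, z = x₀
    · refine ⟨0, fun _ => 1, rfl, fun z hz => ?_⟩
      rw [hone z hz]
      simp
    · push Not at hone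
      obtain ⟨y, hy, hyx⟩ := hone
      obtain ⟨i, hi⟩ := Function.ne_iff.1 hyx
      have hi' : y i - x₀ i ≠ 0 := sub_ne_zero.2 hi
      refine ⟨i, fun j => (y j - x₀ j) / (y i - x₀ i), div_self hi', fun z hz => ?_⟩
      ext j
      simp only [Pi.add_apply, Pi.smul_apply, smul_eq_mul]
      rcases eq_or_ne i j with rfl | hij
      · field_simp
        ring
      · have := hdet y hy z hz i j hij
        field_simp
        linarith
  obtain ⟨i, v, hv, hz⟩ := hline
  have hopen : IsOpen {x : Fin (n + 1) → ℝ | |φ x - φ (x₀ + (x i - x₀ i) • v)| < ω} :=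
    isOpen_lt (by fun_prop) continuous_const
  obtain ⟨k, hk⟩ := exists_subset_nhds_of_isCompact' (V := fun k => (S k).1)
    (directed_of_isDirected_le fun a b hab => hanti hab) hcpt
    (fun k => (hcpt k).isClosed) (U := {x | |φ x - φ (x₀ + (x i - x₀ i) • v)| < ω}) fun x hx => by
      refine hopen.mem_nhds ?_
      show |φ x - φ (x₀ + (x i - x₀ i) • v)| < ω
      rw [← hz x hx]
      simpa using hω
  obtain ⟨hKF, hK, hKc, hK1, hK2⟩ := (S k).2
  exact ⟨(S k).1, hKF, hK, hKc, hK1, hK2, i, x₀, v, hv, fun x hx => hk hx⟩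

lemma eval_aeval_polynomial {σ : Type*} (L : σ → Polynomial ℝ) (u : ℝ) (P : MvPolynomial σ ℝ) :
    (MvPolynomial.aeval L P).eval u = MvPolynomial.eval (fun j => (L j).eval u) P := by
  induction P using MvPolynomial.induction_on with
  | C c => simp
  | add p q hp hq => simp [hp, hq]
  | mul_X p j hp => simp [hp]

lemma exists_polynomial_eval_line {σ : Type*} {d : ℕ} {P : MvPolynomial σ ℝ}
    (hP : P.totalDegree ≤ d) (a v : σ → ℝ) (r : ℝ) :
    ∃ Q : Polynomial ℝ, Q.natDegree ≤ d ∧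
      ∀ u, Q.eval u = MvPolynomial.eval (a + (u - r) • v) P := by
  let L : σ → Polynomial ℝ := fun j =>
    Polynomial.C (v j) * Polynomial.X + Polynomial.C (a j - r * v j)
  have hL : ∀ j, (L j).natDegree ≤ 1 := fun j => Polynomial.natDegree_linear_le
  refine ⟨MvPolynomial.aeval L P, ?_, fun u => ?_⟩
  · have h := MvPolynomial.aeval_natDegree_le P hP L hL
    rwa [mul_one] at h
  · rw [eval_aeval_polynomial]
    congr 2
    ext j
    simp [L]
    ring

lemma rpow_volume_le_of_coord {n d : ℕ} (hd : 1 ≤ d) {K : Set (Fin (n + 1) → ℝ)}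
    (hK : IsCompact K) (hKc : Convex ℝ K) (i : Fin (n + 1)) {Q : Polynomial ℝ}
    (hQ : Q.natDegree ≤ d) {l c : ℝ} (hl : 1 < l) (hc : 0 < c) :
    volume K ^ (1 - l⁻¹) *
      volume (K ∩ {x | (2 * Real.exp 1 * l) ^ d * c ≤ |Q.eval (x i)|}) ^ l⁻¹ ≤
      volume (K ∩ {x | c < |Q.eval (x i)|}) := by
  obtain ⟨R, hR⟩ := hK.isBounded.subset_closedBall (0 : Fin (n + 1) → ℝ)
  have hRx : ∀ x ∈ K, ∀ j, x j ∈ Icc (-R) R := by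
    intro x hx j
    have h1 := mem_closedBall_zero_iff.1 (hR hx)
    exact abs_le.1 ((norm_le_pi_norm x j).trans h1)
  have hcont : Continuous fun x => |Q.eval x| := by fun_prop
  have hKm := hK.isClosed.measurableSet
  have key := rpow_lintegral_polynomial_le (measurable_fiberVolume i hKm)
    (fun s hs0 hs1 => fiberVolume_logConcave i hKm hKc hs0 hs1) (R := R) ?_
    (M := volume (Icc (fun _ : Fin n => -R) fun _ => R)) isCompact_Icc.measure_lt_top.ne ?_ hd hQ hl hc
  · rw [← volume_inter_coord_preimage i hKm (isClosed_le continuous_const hcont).measurableSet,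
      ← volume_inter_coord_preimage i hKm (isOpen_lt continuous_const hcont).measurableSet] at key
    have huniv := volume_inter_coord_preimage i hKm MeasurableSet.univ
    simp only [mem_univ, ofPred_true, inter_univ, Measure.restrict_univ] at huniv
    rw [← huniv] at key
    exact key
  · intro u hu
    obtain ⟨y, hy⟩ := nonempty_of_measure_ne_zero hu
    have hy : (i.insertNth u y : Fin (n + 1) → ℝ) ∈ K := hy
    simpa using hRx _ hy i
  · intro u
    refine measure_mono fun y hy => ?_
    have hy : (i.insertNth u y : Fin (n + 1) → ℝ) ∈ K := hy
    have := fun j => hRx _ hy (i.succAbove j)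
    simp only [Fin.insertNth_apply_succAbove] at this
    exact ⟨fun j => (this j).1, fun j => (this j).2⟩

lemma integrableOn_indicator_one_sub_const {α : Type*} [MeasurableSpace α] {μ : Measure α}
    {K S : Set α} (hK : μ K ≠ ∞) (hS : MeasurableSet S) (q : ℝ) :
    IntegrableOn (fun x => S.indicator 1 x - q) K μ :=
  ((integrableOn_const hK (C := (1 : ℝ))).indicator hS).sub (integrableOn_const hK)

lemma setIntegral_indicator_one_sub_const {α : Type*} [MeasurableSpace α] {μ : Measure α}
    {K S : Set α} (hK : μ K ≠ ∞) (hS : MeasurableSet S) (q : ℝ) :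
    ∫ x in K, (S.indicator 1 x - q) ∂μ = μ.real (K ∩ S) - q * μ.real K := by
  have h1 : IntegrableOn (S.indicator (1 : α → ℝ)) K μ :=
    (integrableOn_const hK (C := (1 : ℝ))).indicator hS
  rw [integral_sub h1 (integrableOn_const hK), setIntegral_indicator hS]
  simp [mul_comm]

lemma rpow_volume_closed_superlevel_le {n d : ℕ} (hd : 1 ≤ d) {P : MvPolynomial (Fin (n + 1)) ℝ}
    (hP : P.totalDegree ≤ d) {F : Set (Fin (n + 1) → ℝ)} (hF : IsCompact F) (hFc : Convex ℝ F)
    (hV : 0 < volume.real F) {l c c' : ℝ} (hl : 1 < l) (hc : 0 < c) (hcc : c < c') :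
    (volume.real (F ∩ {x | (2 * Real.exp 1 * l) ^ d * c' ≤ |MvPolynomial.eval x P|}) /
      volume.real F) ^ l⁻¹ ≤
      volume.real (F ∩ {x | c < |MvPolynomial.eval x P|}) / volume.real F := by
  have hl0 : 0 < l := by linarith
  have hcont : Continuous fun x => |MvPolynomial.eval x P| := (MvPolynomial.continuous_eval P).abs
  set A := {x | (2 * Real.exp 1 * l) ^ d * c' ≤ |MvPolynomial.eval x P|} with hA
  set B := {x | c < |MvPolynomial.eval x P|} with hB
  have hAm : MeasurableSet A := (isClosed_le continuous_const hcont).measurableSet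
  have hBm : MeasurableSet B := (isOpen_lt continuous_const hcont).measurableSet
  set p := volume.real (F ∩ B) / volume.real F with hp
  have hp0 : 0 ≤ p := by positivity
  have he : 2 ≤ Real.exp 1 := by linarith [Real.add_one_le_exp 1]
  have hbig : 1 ≤ (2 * Real.exp 1 * l) ^ d := one_le_pow₀ (by nlinarith)
  by_contra! hlt
  have hlt' : p ^ l < volume.real (F ∩ A) / volume.real F := by
    have := Real.rpow_lt_rpow hp0 hlt hl0
    rwa [← Real.rpow_mul (by positivity), inv_mul_cancel₀ hl0.ne', Real.rpow_one] at this
  obtain ⟨q, hpq, hq⟩ := exists_between hlt'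
  have hq0 : 0 ≤ q := (Real.rpow_nonneg hp0 _).trans hpq.le
  rw [lt_div_iff₀ hV] at hq
  have hFfin := hF.measure_lt_top (μ := volume).ne
  obtain ⟨K, hKF, hK, hKc, hK1, hK2, i, a, v, hv, hφ⟩ := exists_localization hF hFc
    (g₁ := fun x => A.indicator 1 x - q) (g₂ := fun x => -(B.indicator 1 x - p))
    (integrableOn_indicator_one_sub_const hFfin hAm q)
    (integrableOn_indicator_one_sub_const hFfin hBm p).neg
    (by rw [setIntegral_indicator_one_sub_const hFfin hAm]; linarith)
    (by
      rw [integral_neg, setIntegral_indicator_one_sub_const hFfin hBm, hp, div_mul_cancel₀ _ hV.ne']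
      simp)
    hcont (ω := (c' - c) / 2) (by linarith)
  have hKfin := hK.measure_lt_top (μ := volume).ne
  rw [setIntegral_indicator_one_sub_const hKfin hAm] at hK1
  rw [integral_neg, setIntegral_indicator_one_sub_const hKfin hBm] at hK2
  obtain ⟨Q, hQ, hQe⟩ := exists_polynomial_eval_line hP a v (a i)
  have hQφ : ∀ x ∈ K, |(|MvPolynomial.eval x P| - |Q.eval (x i)|)| < (c' - c) / 2 := by
    intro x hx
    rw [hQe]
    exact hφ x hx
  have hKV : 0 < volume.real K := by
    rcases (measureReal_nonneg (μ := volume) (s := K)).eq_or_lt with h0 | h0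
    · have : volume.real (K ∩ A) ≤ volume.real K := measureReal_mono inter_subset_left hKfin
      rw [← h0] at this hK1
      linarith
    · exact h0
  have key := rpow_volume_le_of_coord hd hK hKc i hQ (l := l) (c := (c + c') / 2) hl (by linarith)
  have hfinK : ∀ S, volume (K ∩ S) ≠ ∞ := fun S =>
    ((measure_mono inter_subset_left).trans_lt hKfin.lt_top).ne
  have key' := ENNReal.toReal_mono (hfinK _) key
  rw [ENNReal.toReal_mul, ← ENNReal.toReal_rpow, ← ENNReal.toReal_rpow] at key'
  have hsub1 : volume.real (K ∩ A) ≤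
      volume.real (K ∩ {x | (2 * Real.exp 1 * l) ^ d * ((c + c') / 2) ≤ |Q.eval (x i)|}) := by
    refine measureReal_mono (fun x hx => ⟨hx.1, ?_⟩) (hfinK _)
    have h1 := (abs_lt.1 (hQφ x hx.1)).2
    have h2 : (2 * Real.exp 1 * l) ^ d * c' ≤ |MvPolynomial.eval x P| := hx.2
    show (2 * Real.exp 1 * l) ^ d * ((c + c') / 2) ≤ |Q.eval (x i)|
    nlinarith
  have hsub2 : volume.real (K ∩ {x | (c + c') / 2 < |Q.eval (x i)|}) ≤ volume.real (K ∩ B) := by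
    refine measureReal_mono (fun x hx => ⟨hx.1, ?_⟩) (hfinK _)
    have h1 := (abs_lt.1 (hQφ x hx.1)).1
    have h2 : (c + c') / 2 < |Q.eval (x i)| := hx.2
    show c < |MvPolynomial.eval x P|
    linarith
  simp only [Measure.real] at key' hsub1 hsub2 hK1 hK2 hKV
  set V := (volume K).toReal
  have h1 : V ^ (1 - l⁻¹) * (q * V) ^ l⁻¹ ≤ p * V := by
    calc _ ≤ V ^ (1 - l⁻¹) * (volume (K ∩ {x | (2 * Real.exp 1 * l) ^ d * ((c + c') / 2) ≤
          |Q.eval (x i)|})).toReal ^ l⁻¹ := by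
          gcongr
          linarith
      _ ≤ _ := key'
      _ ≤ _ := by linarith
  rw [Real.mul_rpow hq0 hKV.le, mul_left_comm, ← Real.rpow_add hKV, sub_add_cancel, Real.rpow_one]
    at h1
  have h2 : q ^ l⁻¹ ≤ p := le_of_mul_le_mul_right h1 hKV
  have h3 := Real.rpow_le_rpow (by positivity) h2 hl0.le
  rw [← Real.rpow_mul hq0, inv_mul_cancel₀ hl0.ne', Real.rpow_one] at h3
  linarith

/-- The distributional inequality for polynomials on convex sets. -/
lemma rpow_volume_superlevel_le {n d : ℕ} (hd : 1 ≤ d) {P : MvPolynomial (Fin (n + 1)) ℝ}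
    (hP : P.totalDegree ≤ d) {F : Set (Fin (n + 1) → ℝ)} (hF : IsCompact F) (hFc : Convex ℝ F)
    (hV : 0 < volume.real F) {l c : ℝ} (hl : 1 < l) (hc : 0 < c) :
    volume.real (F ∩ {x | (2 * Real.exp 1 * l) ^ d * c < |MvPolynomial.eval x P|}) /
      volume.real F ≤
      (volume.real (F ∩ {x | c < |MvPolynomial.eval x P|}) / volume.real F) ^ l := by
  have hl0 : 0 < l := by linarith
  have hpow : 0 < (2 * Real.exp 1 * l) ^ d := by positivity
  set p := volume.real (F ∩ {x | c < |MvPolynomial.eval x P|}) / volume.real F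
  let S : ℕ → Set (Fin (n + 1) → ℝ) := fun k =>
    F ∩ {x | (2 * Real.exp 1 * l) ^ d * (c + 1 / ((k : ℝ) + 1)) ≤ |MvPolynomial.eval x P|}
  have hmono : Monotone S := fun j k hjk x hx => ⟨hx.1, by
    refine le_trans ?_ (show (2 * Real.exp 1 * l) ^ d * (c + 1 / ((j : ℝ) + 1)) ≤
      |MvPolynomial.eval x P| from hx.2)
    have : 1 / ((k : ℝ) + 1) ≤ 1 / ((j : ℝ) + 1) := by gcongr
    gcongr⟩
  have hU : ⋃ k, S k = F ∩ {x | (2 * Real.exp 1 * l) ^ d * c < |MvPolynomial.eval x P|} := by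
    ext x
    simp only [S, mem_iUnion, mem_inter_iff, mem_ofPred_eq]
    constructor
    · rintro ⟨k, hx, hk⟩
      refine ⟨hx, lt_of_lt_of_le ?_ hk⟩
      have : 0 < 1 / ((k : ℝ) + 1) := by positivity
      gcongr
      linarith
    · rintro ⟨hx, hlt⟩
      obtain ⟨k, hk⟩ := exists_nat_one_div_lt
        (sub_pos.2 ((lt_div_iff₀' hpow).2 hlt))
      refine ⟨k, hx, ?_⟩
      rw [← le_div_iff₀' hpow]
      linarith
  have hSp : ∀ k, volume.real (S k) / volume.real F ≤ p ^ l := by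
    intro k
    have h := rpow_volume_closed_superlevel_le hd hP hF hFc hV hl hc
      (c' := c + 1 / ((k : ℝ) + 1)) (by have : 0 < 1 / ((k : ℝ) + 1) := by positivity
                                        linarith)
    have h3 := Real.rpow_le_rpow (by positivity) h hl0.le
    rwa [← Real.rpow_mul (by positivity), inv_mul_cancel₀ hl0.ne', Real.rpow_one] at h3
  have hfin : volume (⋃ k, S k) ≠ ∞ := by
    rw [hU]
    exact ((measure_mono inter_subset_left).trans_lt hF.measure_lt_top).ne
  have ht := (ENNReal.tendsto_toReal hfin).comp (tendsto_measure_iUnion_atTop (μ := volume) hmono)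
  rw [hU] at ht
  exact le_of_tendsto (ht.div_const _) (Eventually.of_forall hSp)

lemma measureReal_superlevel_le_of_forall_gt {Ω : Type*} [MeasurableSpace Ω] {ν : Measure Ω}
    [IsFiniteMeasure ν] {f : Ω → ℝ} {a b : ℝ}
    (h : ∀ c, a < c → ν.real {x | c < f x} ≤ b) : ν.real {x | a < f x} ≤ b := by
  let S : ℕ → Set Ω := fun k => {x | a + 1 / ((k : ℝ) + 1) < f x}
  have hmono : Monotone S := fun j k hjk x hx => by
    have hx : a + 1 / ((j : ℝ) + 1) < f x := hx
    have : 1 / ((k : ℝ) + 1) ≤ 1 / ((j : ℝ) + 1) := by gcongr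
    show a + 1 / ((k : ℝ) + 1) < f x
    linarith
  have hU : ⋃ k, S k = {x | a < f x} := by
    ext x
    simp only [S, mem_iUnion, mem_ofPred_eq]
    constructor
    · rintro ⟨k, hk⟩
      have : 0 < 1 / ((k : ℝ) + 1) := by positivity
      linarith
    · intro hx
      obtain ⟨k, hk⟩ := exists_nat_one_div_lt (sub_pos.2 hx)
      exact ⟨k, by linarith⟩
  have ht := (ENNReal.tendsto_toReal (measure_ne_top ν _)).comp
    (tendsto_measure_iUnion_atTop (μ := ν) hmono)
  rw [hU] at ht
  exact le_of_tendsto ht (Eventually.of_forall fun k => h _ (by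
    have : 0 < 1 / ((k : ℝ) + 1) := by positivity
    linarith))

lemma exists_measureReal_superlevel_median {Ω : Type*} [MeasurableSpace Ω] {ν : Measure Ω}
    [IsProbabilityMeasure ν] {f : Ω → ℝ} (hf : Measurable f) (hpos : 1 / 2 < ν.real {x | 0 < f x}) :
    ∃ M, 0 < M ∧ ν.real {x | M < f x} ≤ 1 / 2 ∧
      ∀ c, 0 ≤ c → c < M → 1 / 2 < ν.real {x | c < f x} := by
  let S := {c : ℝ | 0 ≤ c ∧ ν.real {x | c < f x} ≤ 1 / 2}
  have hanti : ∀ a b, a ≤ b → ν.real {x | b < f x} ≤ ν.real {x | a < f x} := fun a b hab =>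
    measureReal_mono fun x hx => lt_of_le_of_lt hab hx
  have hbdd : BddBelow S := ⟨0, fun c hc => hc.1⟩
  have hne : S.Nonempty := by
    have hint : ⋂ k : ℕ, {x | (k : ℝ) < f x} = ∅ := by
      ext x
      simp only [mem_iInter, mem_ofPred_eq, mem_empty_iff_false, iff_false, not_forall, not_lt]
      exact exists_nat_ge (f x)
    have ht := tendsto_measure_iInter_atTop (μ := ν) (s := fun k : ℕ => {x | (k : ℝ) < f x})
      (fun k => (measurableSet_lt measurable_const hf).nullMeasurableSet)
      (fun j k hjk x (hx : (k : ℝ) < f x) => lt_of_le_of_lt (Nat.cast_le.2 hjk) hx) ⟨0, measure_ne_top _ _⟩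
    rw [hint, measure_empty] at ht
    have ht' := (ENNReal.tendsto_toReal ENNReal.zero_ne_top).comp ht
    obtain ⟨k, hk⟩ := (ht'.eventually (gt_mem_nhds (show (0 : ℝ≥0∞).toReal < 1 / 2 by simp))).exists
    exact ⟨k, Nat.cast_nonneg k, le_of_lt hk⟩
  have hlow : ∀ c, 0 ≤ c → c < sInf S → 1 / 2 < ν.real {x | c < f x} := fun c hc0 hc => by
    by_contra! h
    exact notMem_of_lt_csInf hc hbdd ⟨hc0, h⟩
  have hM : ν.real {x | sInf S < f x} ≤ 1 / 2 :=
    measureReal_superlevel_le_of_forall_gt fun c hc => by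
      obtain ⟨s, hs, hsc⟩ := exists_lt_of_csInf_lt hne hc
      exact (hanti s c hsc.le).trans hs.2
  refine ⟨sInf S, ?_, hM, hlow⟩
  refine (le_csInf hne fun c hc => hc.1).lt_of_ne fun h0 => ?_
  rw [← h0] at hM
  linarith

lemma one_sub_exp_neg_le {y : ℝ} (hy0 : 0 ≤ y) (hy1 : y ≤ 1) :
    1 - Real.exp (-y) ≤ y - y ^ 2 / 2 + y ^ 3 / 6 := by
  have h := (abs_le.1 (Real.exp_bound (x := -y) (by rwa [abs_neg, abs_of_nonneg hy0])
    (n := 5) (by norm_num))).1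
  rw [abs_neg, abs_of_nonneg hy0] at h
  simp [Finset.sum_range_succ, Nat.factorial] at h
  have h4 : 0 ≤ y ^ 4 := by positivity
  have h5 : y ^ 5 ≤ y ^ 4 := pow_le_pow_of_le_one hy0 hy1 (by norm_num)
  nlinarith

/-- A rational function for which `-exp (-x) * expTailRat x` dominates the antiderivative of
`exp (-x) / x` on the positive half-line. -/
noncomputable def expTailRat (x : ℝ) : ℝ :=
  (x ^ 2 + 5 * x + 2) / (x ^ 3 + 6 * x ^ 2 + 6 * x)

lemma expTailRat_bounds {x : ℝ} (hx : 0 < x) : 0 ≤ expTailRat x ∧ expTailRat x ≤ x⁻¹ := by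
  refine ⟨by unfold expTailRat; positivity, ?_⟩
  rw [expTailRat, div_le_iff₀ (by positivity), inv_mul_eq_div, le_div_iff₀ hx]
  nlinarith

lemma exists_hasDerivAt_expTailRat {x : ℝ} (hx : 0 < x) :
    ∃ r, HasDerivAt expTailRat r x ∧ 1 ≤ x * (expTailRat x - r) := by
  have hD : x ^ 3 + 6 * x ^ 2 + 6 * x ≠ 0 := by positivity
  have h1 : HasDerivAt (fun x : ℝ => x ^ 2 + 5 * x + 2) (2 * x + 5) x :=
    (((hasDerivAt_pow 2 x).add ((hasDerivAt_id' x).const_mul 5)).add_const 2).congr_deriv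
      (by simp)
  have h2 : HasDerivAt (fun x : ℝ => x ^ 3 + 6 * x ^ 2 + 6 * x) (3 * x ^ 2 + 12 * x + 6) x :=
    (((hasDerivAt_pow 3 x).add ((hasDerivAt_pow 2 x).const_mul 6)).add
      ((hasDerivAt_id' x).const_mul 6)).congr_deriv (by norm_num; ring)
  refine ⟨_, h1.div h2 hD, ?_⟩
  have : x * (expTailRat x - ((2 * x + 5) * (x ^ 3 + 6 * x ^ 2 + 6 * x) -
      (x ^ 2 + 5 * x + 2) * (3 * x ^ 2 + 12 * x + 6)) / (x ^ 3 + 6 * x ^ 2 + 6 * x) ^ 2) - 1 =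
      12 * x / (x ^ 3 + 6 * x ^ 2 + 6 * x) ^ 2 := by
    unfold expTailRat
    field_simp
    ring
  have h3 : 0 ≤ 12 * x / (x ^ 3 + 6 * x ^ 2 + 6 * x) ^ 2 := by positivity
  linarith

lemma lintegral_tail_le_one :
    ∫⁻ s in Ioi (0 : ℝ), ENNReal.ofReal (Real.exp (-(Real.log 2 * Real.exp s)) +
      (1 - Real.exp (-(Real.log 2 * Real.exp (-s))))) ≤ 1 := by
  set L := Real.log 2 with hL
  have hL0 : 0 < L := Real.log_pos one_lt_two
  have hL1 := Real.log_two_lt_d9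
  have hL2 := Real.log_two_gt_d9
  rw [← hL] at hL1 hL2
  let K : ℝ → ℝ := fun s => -(Real.exp (-(L * Real.exp s)) * expTailRat (L * Real.exp s)) -
    (L * Real.exp (-s) - (L * Real.exp (-s)) ^ 2 / 4 + (L * Real.exp (-s)) ^ 3 / 18)
  have hder : ∀ s, 0 ≤ s → ∃ k, HasDerivAt K k s ∧ Real.exp (-(L * Real.exp s)) +
      (1 - Real.exp (-(L * Real.exp (-s)))) ≤ k := by
    intro s hs
    have hx : HasDerivAt (fun s => L * Real.exp s) (L * Real.exp s) s :=
      (Real.hasDerivAt_exp s).const_mul L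
    have hy : HasDerivAt (fun s => L * Real.exp (-s)) (-(L * Real.exp (-s))) s :=
      (((Real.hasDerivAt_exp (-s)).comp s (hasDerivAt_neg s)).const_mul L).congr_deriv (by ring)
    have hx0 : 0 < L * Real.exp s := by positivity
    have hy0 : 0 < L * Real.exp (-s) := by positivity
    have hy1 : L * Real.exp (-s) ≤ 1 := by
      have : Real.exp (-s) ≤ 1 := Real.exp_le_one_iff.2 (by linarith)
      nlinarith
    obtain ⟨r, hr, hr1⟩ := exists_hasDerivAt_expTailRat hx0
    have hE : HasDerivAt (fun s => Real.exp (-(L * Real.exp s)))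
        (Real.exp (-(L * Real.exp s)) * -(L * Real.exp s)) s :=
      hx.fun_neg.exp
    have hR : HasDerivAt (fun s => expTailRat (L * Real.exp s)) (r * (L * Real.exp s)) s :=
      HasDerivAt.comp (h₂ := expTailRat) s hr hx
    have hpoly := (hy.sub ((hy.pow 2).div_const 4)).add ((hy.pow 3).div_const 18)
    have h1 := one_sub_exp_neg_le hy0.le hy1
    have h2 : 0 < Real.exp (-(L * Real.exp s)) := Real.exp_pos _
    have h3 := mul_le_mul_of_nonneg_left hr1 h2.le
    refine ⟨Real.exp (-(L * Real.exp s)) * (L * Real.exp s * (expTailRat (L * Real.exp s) - r)) +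
      (L * Real.exp (-s) - (L * Real.exp (-s)) ^ 2 / 2 + (L * Real.exp (-s)) ^ 3 / 6),
      (((hE.mul hR).neg).sub hpoly).congr_deriv ?_, by linarith⟩
    push_cast
    ring
  choose! k hk hkle using hder
  have hk0 : ∀ s, 0 ≤ s → 0 ≤ k s := fun s hs => by
    refine le_trans ?_ (hkle s hs)
    have : Real.exp (-(L * Real.exp (-s))) ≤ 1 := Real.exp_le_one_iff.2 (by
      have : 0 < L * Real.exp (-s) := by positivity
      linarith)
    have := Real.exp_pos (-(L * Real.exp s))
    linarith
  have hexp : Tendsto (fun s => Real.exp (-s)) atTop (𝓝 0) := Real.tendsto_exp_neg_atTop_nhds_zero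
  have hlim : Tendsto K atTop (𝓝 0) := by
    have hy : Tendsto (fun s => L * Real.exp (-s)) atTop (𝓝 0) := by
      simpa using hexp.const_mul L
    have h1 : Tendsto (fun s => Real.exp (-(L * Real.exp s)) * expTailRat (L * Real.exp s)) atTop
        (𝓝 0) := by
      refine squeeze_zero (g := fun s => L⁻¹ * Real.exp (-s)) (fun s => ?_) (fun s => ?_)
        (by simpa using hexp.const_mul L⁻¹)
      · have := (expTailRat_bounds (x := L * Real.exp s) (by positivity)).1
        positivity
      · have hx0 : 0 < L * Real.exp s := by positivity
        have h2 := expTailRat_bounds hx0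
        have h3 : Real.exp (-(L * Real.exp s)) ≤ 1 := Real.exp_le_one_iff.2 (by linarith)
        rw [Real.exp_neg s, ← mul_inv]
        nlinarith
    simpa using h1.neg.sub ((hy.sub ((hy.pow 2).div_const 4)).add ((hy.pow 3).div_const 18))
  have hcont : ContinuousWithinAt K (Ici 0) 0 := (hk 0 le_rfl).continuousAt.continuousWithinAt
  have hI := integral_Ioi_of_hasDerivAt_of_nonneg hcont (fun s hs => hk s (le_of_lt hs))
    (fun s hs => hk0 s (le_of_lt hs)) hlim
  have hint := integrableOn_Ioi_deriv_of_nonneg hcont (fun s hs => hk s (le_of_lt hs))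
    (fun s hs => hk0 s (le_of_lt hs)) hlim
  have hK0 : -K 0 ≤ 1 := by
    have hE : Real.exp (-L) = 1 / 2 := by
      rw [Real.exp_neg, hL, Real.exp_log two_pos]
      norm_num
    simp only [K, neg_zero, Real.exp_zero, mul_one, hE, expTailRat]
    have hR : (L ^ 2 + 5 * L + 2) / (L ^ 3 + 6 * L ^ 2 + 6 * L) ≤ 0.81 := by
      rw [div_le_iff₀ (by positivity)]
      nlinarith [pow_pos hL0 2, pow_pos hL0 3]
    have hL3 : L ^ 3 ≤ 0.3331 := by
      calc L ^ 3 ≤ 0.6931471808 ^ 3 := by gcongr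
        _ ≤ _ := by norm_num
    have hL4 : 0.48045 ≤ L ^ 2 := by
      calc _ ≤ (0.6931471803 : ℝ) ^ 2 := by norm_num
        _ ≤ _ := by gcongr
    linarith
  calc _ ≤ ∫⁻ s in Ioi (0 : ℝ), ENNReal.ofReal (k s) :=
        setLIntegral_mono' measurableSet_Ioi fun s hs =>
          ENNReal.ofReal_le_ofReal (hkle s (le_of_lt hs))
    _ = ENNReal.ofReal (∫ s in Ioi (0 : ℝ), k s) :=
        (ofReal_integral_eq_lintegral_ofReal hint
          ((ae_restrict_iff' measurableSet_Ioi).2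
            (Eventually.of_forall fun s hs => hk0 s (le_of_lt hs)))).symm
    _ ≤ 1 := by
        rw [hI, ENNReal.ofReal_le_one]
        linarith

lemma measureReal_pos_superlevel_eq_one {Ω : Type*} [MeasurableSpace Ω] {ν : Measure Ω}
    [IsProbabilityMeasure ν] {f : Ω → ℝ} {d : ℕ} (hpos : 0 < ν.real {x | 0 < f x})
    (htail : ∀ l c, 1 < l → 0 < c →
      ν.real {x | (2 * Real.exp 1 * l) ^ d * c < f x} ≤ ν.real {x | c < f x} ^ l) :
    ν.real {x | 0 < f x} = 1 := by
  refine le_antisymm measureReal_le_one ?_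
  have h : ν.real {x | 0 < f x} ≤ ν.real {x | 0 < f x} ^ 2 :=
    measureReal_superlevel_le_of_forall_gt fun c hc => by
      have hm : 0 < (2 * Real.exp 1 * 2) ^ d := by positivity
      have h := htail 2 (c / (2 * Real.exp 1 * 2) ^ d) one_lt_two (by positivity)
      rw [mul_div_cancel₀ _ hm.ne', Real.rpow_two] at h
      refine h.trans ?_
      exact pow_le_pow_left₀ measureReal_nonneg (measureReal_mono fun x (hx : _ < f x) =>
        (show (0 : ℝ) < c / (2 * Real.exp 1 * 2) ^ d by positivity).trans hx) 2
  nlinarith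

/-- A power-type tail inequality bounds the mean oscillation of the logarithm. -/
lemma exists_lintegral_abs_log_sub_le {Ω : Type*} [MeasurableSpace Ω] {ν : Measure Ω}
    [IsProbabilityMeasure ν] {f : Ω → ℝ} (hf : Measurable f) {d : ℕ} (hd : 1 ≤ d)
    (hf0 : ∀ x, 0 ≤ f x) (hpos : 0 < ν.real {x | 0 < f x})
    (htail : ∀ l c, 1 < l → 0 < c →
      ν.real {x | (2 * Real.exp 1 * l) ^ d * c < f x} ≤ ν.real {x | c < f x} ^ l) :
    ∃ C, ∫⁻ x, ENNReal.ofReal |Real.log (f x) - C| ∂ν ≤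
      ENNReal.ofReal ((2 + Real.log 2) * d) := by
  obtain ⟨M, hM, hMhi, hMlo⟩ := exists_measureReal_superlevel_median hf (ν := ν)
    (by rw [measureReal_pos_superlevel_eq_one hpos htail]; norm_num)
  have hd0 : (0 : ℝ) < d := by exact_mod_cast hd
  set T := 1 + Real.log 2 with hT
  have hT0 : 0 < T := by positivity
  have hscale : ∀ t, (2 * Real.exp 1 * Real.exp (t - T)) ^ d = Real.exp (d * t) := fun t => by
    rw [Real.exp_nat_mul]
    congr 1
    nth_rw 1 [← Real.exp_log two_pos]
    rw [← Real.exp_add, ← Real.exp_add]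
    congr 1
    rw [hT]
    ring
  have hhalf : ∀ y : ℝ, (1 / 2 : ℝ) ^ y = Real.exp (-(Real.log 2 * y)) := fun y => by
    rw [Real.rpow_def_of_pos (by norm_num), one_div, Real.log_inv, neg_mul]
  let g : Ω → ℝ := fun x => |Real.log (f x) - Real.log M| / d
  have hg : Measurable g := by fun_prop
  have hup : ∀ t, T < t → ν.real {x | Real.exp (d * t) * M < f x} ≤
      Real.exp (-(Real.log 2 * Real.exp (t - T))) := fun t ht => by
    have h := htail (Real.exp (t - T)) M (Real.one_lt_exp_iff.2 (by linarith)) hM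
    rw [hscale] at h
    refine h.trans ?_
    rw [← hhalf]
    gcongr
  have hdown : ∀ t, T < t → ν.real {x | f x < Real.exp (-(d * t)) * M} ≤
      1 - Real.exp (-(Real.log 2 * Real.exp (-(t - T)))) := fun t ht => by
    have h := measureReal_superlevel_le_of_forall_gt (ν := ν) (f := fun x => -f x)
      (a := -(Real.exp (-(d * t)) * M))
      (b := 1 - Real.exp (-(Real.log 2 * Real.exp (-(t - T))))) fun c' hc' => by
        rcases le_or_gt 0 c' with hc0 | hc0
        · have : {x | c' < -f x} = ∅ := by
            ext x
            have := hf0 x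
            simp only [mem_ofPred_eq, mem_empty_iff_false, iff_false, not_lt]
            linarith
          rw [this, measureReal_empty, sub_nonneg, Real.exp_le_one_iff]
          have : 0 < Real.log 2 := Real.log_pos one_lt_two
          have : 0 < Real.log 2 * Real.exp (-(t - T)) := by positivity
          linarith
        · have h1 : 1 < Real.exp (t - T) := Real.one_lt_exp_iff.2 (by linarith)
          have h := htail (Real.exp (t - T)) (-c') h1 (by linarith)
          rw [hscale] at h
          have h2 := hMlo (Real.exp (d * t) * -c')
            (mul_nonneg (Real.exp_pos _).le (by linarith)) (by
              have h3 : -c' < Real.exp (-(d * t)) * M := by linarith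
              calc _ < Real.exp (d * t) * (Real.exp (-(d * t)) * M) := by gcongr
                _ = M := by rw [← mul_assoc, ← Real.exp_add]; simp)
          have h3 := Real.rpow_le_rpow (by norm_num) (h2.le.trans h)
            (Real.exp_pos (-(t - T))).le
          rw [← Real.rpow_mul measureReal_nonneg, ← Real.exp_add, add_neg_cancel, Real.exp_zero,
            Real.rpow_one, hhalf] at h3
          have h4 : {x | c' < -f x}ᶜ ⊇ {x | -c' < f x} := fun x (hx : -c' < f x) => by
            simp only [mem_compl_iff, mem_ofPred_eq, not_lt]
            linarith
          have h5 := measureReal_mono h4 (measure_ne_top ν _)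
          rw [probReal_compl_eq_one_sub (show MeasurableSet {x | c' < -f x} from
            measurableSet_lt measurable_const hf.neg)] at h5
          linarith
    simpa only [neg_lt_neg_iff] using h
  have hgt : ∀ t, T < t → ν {x | t < g x} ≤ ENNReal.ofReal
      (Real.exp (-(Real.log 2 * Real.exp (t - T))) +
        (1 - Real.exp (-(Real.log 2 * Real.exp (-(t - T)))))) := fun t ht => by
    rw [← ofReal_measureReal]
    refine ENNReal.ofReal_le_ofReal ?_
    have hsub : {x | t < g x} ⊆
        {x | Real.exp (d * t) * M < f x} ∪ {x | f x < Real.exp (-(d * t)) * M} := by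
      intro x (hx : t < g x)
      rcases (hf0 x).eq_or_lt with h0 | h0
      · right
        show f x < _
        rw [← h0]
        positivity
      · rw [lt_div_iff₀ hd0, lt_abs] at hx
        rcases hx with hx | hx
        · left
          show Real.exp (d * t) * M < f x
          rw [← Real.exp_log hM, ← Real.exp_add, ← Real.lt_log_iff_exp_lt h0]
          linarith
        · right
          show f x < Real.exp (-(d * t)) * M
          rw [← Real.exp_log hM, ← Real.exp_add, ← Real.log_lt_iff_lt_exp h0]
          linarith
    calc _ ≤ _ := measureReal_mono hsub
      _ ≤ _ := measureReal_union_le _ _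
      _ ≤ _ := add_le_add (hup t ht) (hdown t ht)
  have hlayer : ∫⁻ x, ENNReal.ofReal (g x) ∂ν ≤ ENNReal.ofReal (T + 1) := by
    rw [lintegral_eq_lintegral_meas_lt ν (Eventually.of_forall fun x => by positivity)
      hg.aemeasurable, ← Ioc_union_Ioi_eq_Ioi hT0.le, ENNReal.ofReal_add hT0.le zero_le_one]
    refine (lintegral_union_le _ _ _).trans (add_le_add ?_ ?_)
    · calc _ ≤ ∫⁻ t in Ioc 0 T, 1 := lintegral_mono fun t => prob_le_one
        _ = _ := by simp
    · refine (setLIntegral_mono' measurableSet_Ioi hgt).trans ?_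
      have hpre : (fun t : ℝ => t - T) ⁻¹' Ioi 0 = Ioi T := by
        ext t
        simp
      have := (measurePreserving_sub_right (volume : Measure ℝ) T).setLIntegral_comp_preimage_emb
        (MeasurableEquiv.subRight T).measurableEmbedding
        (fun s => ENNReal.ofReal (Real.exp (-(Real.log 2 * Real.exp s)) +
          (1 - Real.exp (-(Real.log 2 * Real.exp (-s)))))) (Ioi 0)
      rw [hpre] at this
      rw [this, ENNReal.ofReal_one]
      exact lintegral_tail_le_one
  refine ⟨Real.log M, ?_⟩
  calc ∫⁻ x, ENNReal.ofReal |Real.log (f x) - Real.log M| ∂ν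
      = ∫⁻ x, ENNReal.ofReal (g x) * ENNReal.ofReal d ∂ν := by
        congr 1 with x
        rw [← ENNReal.ofReal_mul (by positivity), div_mul_cancel₀ _ hd0.ne']
    _ = (∫⁻ x, ENNReal.ofReal (g x) ∂ν) * ENNReal.ofReal d :=
        lintegral_mul_const _ hg.ennreal_ofReal
    _ ≤ ENNReal.ofReal (T + 1) * ENNReal.ofReal d := by gcongr
    _ = _ := by
        rw [← ENNReal.ofReal_mul (by positivity)]
        congr 1
        rw [hT]
        ring

lemma volume_inter_superlevel_pos {n : ℕ} {P : MvPolynomial (Fin n) ℝ} (hP : P ≠ 0)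
    {F : Set (Fin n → ℝ)} (hFc : Convex ℝ F) (hV : 0 < volume F) :
    0 < volume (F ∩ {x | 0 < |MvPolynomial.eval x P|}) := by
  have hint : (interior F).Nonempty := by
    by_contra! h
    have := hFc.addHaar_frontier (μ := volume)
    have hsub : F ⊆ frontier F := by
      rw [frontier, h, sdiff_empty]
      exact subset_closure
    exact hV.ne' (measure_mono_null hsub this)
  have hopen : IsOpen (interior F ∩ {x | 0 < |MvPolynomial.eval x P|}) :=
    isOpen_interior.inter (isOpen_lt continuous_const (MvPolynomial.continuous_eval P).abs)
  have hne : (interior F ∩ {x | 0 < |MvPolynomial.eval x P|}).Nonempty := by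
    by_contra! h
    obtain ⟨a, ha⟩ := hint
    obtain ⟨ε, hε, hball⟩ := Metric.isOpen_iff.1 isOpen_interior a ha
    refine hP (MvPolynomial.funext_set (fun i => Ioo (a i - ε) (a i + ε))
      (fun i => Ioo_infinite (by linarith)) fun x hx => ?_)
    by_contra hne
    have hx' : x ∈ interior F := hball (by
      rw [Metric.mem_ball, dist_pi_lt_iff hε]
      intro i
      have := hx i (mem_univ i)
      rw [Real.dist_eq, abs_lt]
      constructor <;> linarith [this.1, this.2])
    rw [map_zero] at hne
    exact (h ▸ ⟨hx', abs_pos.2 hne⟩ : x ∈ (∅ : Set (Fin n → ℝ)))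
  exact (hopen.measure_pos volume hne).trans_le
    (measure_mono (inter_subset_inter_left _ interior_subset))

lemma exists_setIntegral_abs_log_sub_le {n d : ℕ} {P : MvPolynomial (Fin n) ℝ}
    (hPd : P.totalDegree ≤ d) (hPnc : ∀ c : ℝ, P ≠ MvPolynomial.C c) {F : Set (Fin n → ℝ)}
    (hF : IsCompact F) (hFc : Convex ℝ F) (hV : 0 < volume F) :
    ∃ C : ℝ, (1 / (volume F).toReal) *
      (∫ x in F, |Real.log |MvPolynomial.eval x P| - C|) ≤ (2 + Real.log 2) * d := by
  obtain _ | n := n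
  · exact absurd (MvPolynomial.eq_C_of_isEmpty P) (hPnc _)
  have hd : 1 ≤ d := by
    by_contra! h
    exact hPnc _ (MvPolynomial.totalDegree_eq_zero_iff_eq_C.1 (by omega))
  have hfin : volume F ≠ ∞ := hF.measure_lt_top.ne
  have hVr : 0 < volume.real F := ENNReal.toReal_pos hV.ne' hfin
  have hFm := hF.isClosed.measurableSet
  set ν : Measure (Fin (n + 1) → ℝ) := (volume F)⁻¹ • volume.restrict F with hν
  have hνS : ∀ S, MeasurableSet S → ν.real S = volume.real (F ∩ S) / volume.real F := by
    intro S hS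
    rw [hν, measureReal_ennreal_smul_apply, measureReal_restrict_apply hS, ENNReal.toReal_inv,
      inter_comm, div_eq_inv_mul]
    rfl
  have : IsProbabilityMeasure ν := ⟨by
    rw [hν, Measure.smul_apply, Measure.restrict_apply_univ, smul_eq_mul,
      ENNReal.inv_mul_cancel hV.ne' hfin]⟩
  have hcont : Continuous fun x => |MvPolynomial.eval x P| := (MvPolynomial.continuous_eval P).abs
  have hmeas : ∀ c, MeasurableSet {x | c < |MvPolynomial.eval x P|} := fun c =>
    (isOpen_lt continuous_const hcont).measurableSet
  obtain ⟨C, hC⟩ := exists_lintegral_abs_log_sub_le (ν := ν) hcont.measurable hd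
    (fun x => abs_nonneg _)
    (by
      rw [hνS _ (hmeas 0)]
      refine div_pos (ENNReal.toReal_pos (volume_inter_superlevel_pos
        (fun h => hPnc 0 (by rw [h, map_zero])) hFc hV).ne' ?_) hVr
      exact ((measure_mono inter_subset_left).trans_lt hfin.lt_top).ne)
    (fun l c hl hc => by
      rw [hνS _ (hmeas _), hνS _ (hmeas _)]
      exact rpow_volume_superlevel_le hd hPd hF hFc hVr hl hc)
  refine ⟨C, ?_⟩
  have hint : (1 / (volume F).toReal) * (∫ x in F, |Real.log |MvPolynomial.eval x P| - C|) =
      ∫ x, |Real.log |MvPolynomial.eval x P| - C| ∂ν := by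
    rw [hν, integral_smul_measure, ENNReal.toReal_inv, one_div, smul_eq_mul]
  have hm : Measurable fun x => |Real.log |MvPolynomial.eval x P| - C| := by
    have := hcont.measurable
    fun_prop
  rw [hint, integral_eq_lintegral_of_nonneg_ae (Eventually.of_forall fun x => abs_nonneg _)
    hm.aestronglyMeasurable]
  refine ENNReal.toReal_le_of_le_ofReal ?_ hC
  have : 0 ≤ Real.log 2 := Real.log_nonneg one_le_two
  positivity

end

/-- The BMO-norm estimate for `log|P|`: for every compact convex set `F` of positive
volume there is a constant `C` with
`(1/Vol F) ∫_F |log|P| - C| ≤ ((4 + log 4)/2)·d`; in particular the BMO norm of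
`log|P|` (the sup over compact convex `F` of the inf over `C` of these averages)
is at most `((4 + log 4)/2)·d`. -/
theorem bmo_estimate {n : ℕ} (d : ℕ) (P : MvPolynomial (Fin n) ℝ)
    (hPd : P.totalDegree ≤ d) (hPnc : ∀ c : ℝ, P ≠ MvPolynomial.C c) :
    (∀ F : Set (EuclideanSpace ℝ (Fin n)), IsCompact F → Convex ℝ F → 0 < volume F →
      ∃ C : ℝ, (1 / (volume F).toReal) *
          (∫ x in F, |Real.log |MvPolynomial.eval (fun i => x i) P| - C|) ≤
        ((4 + Real.log 4) / 2) * d) ∧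
    sSup {v : ℝ | ∃ F : Set (EuclideanSpace ℝ (Fin n)),
        IsCompact F ∧ Convex ℝ F ∧ 0 < volume F ∧
        v = sInf {w : ℝ | ∃ C : ℝ, w = (1 / (volume F).toReal) *
          (∫ x in F, |Real.log |MvPolynomial.eval (fun i => x i) P| - C|)}} ≤
      ((4 + Real.log 4) / 2) * d := by
  have hlog : (4 + Real.log 4) / 2 = 2 + Real.log 2 := by
    rw [show (4 : ℝ) = 2 ^ 2 by norm_num, Real.log_pow]
    norm_num
    ring
  have main : ∀ F : Set (EuclideanSpace ℝ (Fin n)), IsCompact F → Convex ℝ F → 0 < volume F →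
      ∃ C : ℝ, (1 / (volume F).toReal) *
          (∫ x in F, |Real.log |MvPolynomial.eval (fun i => x i) P| - C|) ≤
        ((4 + Real.log 4) / 2) * d := by
    intro F hF hFc hV
    let e := EuclideanSpace.equiv (Fin n) ℝ
    have hpre : (WithLp.ofLp : EuclideanSpace ℝ (Fin n) → Fin n → ℝ) ⁻¹' (e '' F) = F :=
      e.injective.preimage_image F
    have hmp := PiLp.volume_preserving_ofLp (Fin n)
    have hemb : MeasurableEmbedding (WithLp.ofLp : EuclideanSpace ℝ (Fin n) → Fin n → ℝ) :=
      (MeasurableEquiv.toLp 2 (Fin n → ℝ)).symm.measurableEmbedding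
    have hvol : volume (e '' F) = volume F := by
      rw [← hmp.measure_preimage_emb hemb, hpre]
    obtain ⟨C, hC⟩ := exists_setIntegral_abs_log_sub_le hPd hPnc (hF.image e.continuous)
      (hFc.linear_image e.toLinearEquiv.toLinearMap) (hvol ▸ hV)
    refine ⟨C, ?_⟩
    rw [hvol, ← hmp.setIntegral_preimage_emb hemb, hpre] at hC
    rwa [hlog]
  refine ⟨main, Real.sSup_le ?_ ?_⟩
  · rintro v ⟨F, hF, hFc, hV, rfl⟩
    obtain ⟨C, hC⟩ := main F hF hFc hV
    refine le_trans (csInf_le ⟨0, ?_⟩ ⟨C, rfl⟩) hC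
    rintro w ⟨C, rfl⟩
    exact mul_nonneg (by positivity) (integral_nonneg fun x => abs_nonneg _)
  · rw [hlog]
    have : 0 ≤ Real.log 2 := Real.log_nonneg one_le_two
    positivity
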